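/- arXiv:2510.27590 — 6 statements merged into one kernel-verified Lean document; each statement's English description precedes it below -/
import Mathlib

section
/- For every positive rational k with √k irrational and every κ ∈ (0, 1) there exists a positive constant C = C(k, κ) such that for every N ∈ [1, ∞), q ∈ ℕ, a, b ∈ ℤ and t ∈ ℝ, one has | (1/⌊N⌋) ∑_{1 ≤ n ≤ N} e( ((a + b√k)/q + t) · n⌊n√k⌋ ) − G_k(a, b, q) · F(b/(2q)) · V_{N;k}(t) | ≤ C ( N^{κ−1} + |t| N^{1+κ} + q²(1 + |b|)(1 + log N) N^{−κ/2} ). -/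
open MeasureTheory

/-- `e(x) = exp(2πix)`. -/
noncomputable def expc (x : ℝ) : ℂ := Complex.exp (2 * Real.pi * Complex.I * x)

/-- The arithmetic factor
`G_k(a,b,q) = 𝔼_{r,s ∈ [2qk₂]} e((a/q) r s + (b/(2qk₂))(k₁ r² + k₂ s²))` for `k = k₁/k₂`. -/
noncomputable def Gfactor (k₁ k₂ : ℕ) (a b : ℤ) (q : ℕ) : ℂ :=
  (((2 * q * k₂ : ℕ) : ℂ) ^ 2)⁻¹ *
    ∑ r ∈ Finset.Icc 1 (2 * q * k₂), ∑ s ∈ Finset.Icc 1 (2 * q * k₂),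
      expc ((a : ℝ) / q * r * s +
        (b : ℝ) / (2 * q * k₂) * ((k₁ : ℝ) * (r : ℝ) ^ 2 + (k₂ : ℝ) * (s : ℝ) ^ 2))

/-- `F(ξ) = ∫₀¹ e(−ξ x²) dx`. -/
noncomputable def Ffactor (ξ : ℝ) : ℂ := ∫ x in (0 : ℝ)..1, expc (-(ξ * x ^ 2))

/-- `V_{N;k}(t) = (1/N) ∫₀ᴺ e(t √k x²) dx`. -/
noncomputable def Vfactor (k N t : ℝ) : ℂ :=
  ((N : ℂ))⁻¹ * ∫ x in (0 : ℝ)..N, expc (t * Real.sqrt k * x ^ 2)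

lemma norm_expc (x : ℝ) : ‖expc x‖ = 1 := by
  have : (2 * Real.pi * Complex.I * x : ℂ) = ((2 * Real.pi * x : ℝ) : ℂ) * Complex.I := by
    push_cast; ring
  rw [expc, this, Complex.norm_exp_ofReal_mul_I]

lemma expc_add (x y : ℝ) : expc (x + y) = expc x * expc y := by
  rw [expc, expc, expc, ← Complex.exp_add]
  push_cast
  ring_nf

lemma expc_intCast (n : ℤ) : expc n = 1 := by
  rw [expc, ← Complex.exp_int_mul_two_pi_mul_I n]
  push_cast
  ring_nf

lemma expc_eq_of_sub_eq_intCast {x y : ℝ} (n : ℤ) (h : x = y + n) : expc x = expc y := by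
  rw [h, expc_add, expc_intCast, mul_one]

lemma norm_expc_sub_expc_le (x y : ℝ) : ‖expc x - expc y‖ ≤ 2 * Real.pi * |x - y| := by
  have h1 : expc x = expc y * expc (x - y) := by rw [← expc_add]; ring_nf
  have h2 : expc (x - y) = Complex.exp (Complex.I * ((2 * Real.pi * (x - y) : ℝ) : ℂ)) := by
    rw [expc]; push_cast; ring_nf
  calc ‖expc x - expc y‖ = ‖expc y * (expc (x - y) - 1)‖ := by rw [h1]; ring_nf
    _ = ‖expc (x - y) - 1‖ := by rw [norm_mul, norm_expc, one_mul]
    _ ≤ ‖2 * Real.pi * (x - y)‖ := by rw [h2]; exact Real.norm_exp_I_mul_ofReal_sub_one_le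
    _ = 2 * Real.pi * |x - y| := by
      rw [norm_mul, Real.norm_eq_abs, Real.norm_eq_abs, abs_of_pos Real.two_pi_pos]

lemma continuous_expc : Continuous expc := by
  unfold expc
  fun_prop

/-- Multiplication by a unit permutes the residues modulo `Q`. -/
lemma sum_periodic_mul_div {E : Type*} [AddCommMonoid E] {h : ℝ → E}
    (hper : Function.Periodic h 1) {p : ℤ} {Q : ℕ} (hQ : 0 < Q) (hp : IsCoprime p (Q : ℤ)) :
    ∑ j ∈ Finset.range Q, h ((j : ℝ) * ((p : ℝ) / Q)) =
      ∑ j ∈ Finset.range Q, h ((j : ℝ) / Q) := by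
  have hQ' : (Q : ℝ) ≠ 0 := by positivity
  have hred : ∀ m : ℤ, h ((m : ℝ) / Q) = h (((m % (Q : ℤ) : ℤ) : ℝ) / Q) := by
    intro m
    have : (m : ℝ) / Q = ((m % (Q : ℤ) : ℤ) : ℝ) / Q + ((m / (Q : ℤ) : ℤ) : ℝ) * 1 := by
      have := Int.emod_add_mul_ediv m (Q : ℤ)
      have h2 : (m : ℝ) = ((m % (Q : ℤ) : ℤ) : ℝ) + (Q : ℝ) * ((m / (Q : ℤ) : ℤ) : ℝ) := by
        exact_mod_cast this.symm
      field_simp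
      linarith
    rw [this, hper.int_mul (m / (Q : ℤ))]
  have hmod : ∀ m : ℤ, (((m % (Q : ℤ)).toNat : ℕ) : ℤ) = m % (Q : ℤ) := fun m =>
    Int.toNat_of_nonneg (Int.emod_nonneg _ (by positivity))
  obtain ⟨u, v, huv⟩ := hp
  have key : ∀ x y : ℤ, x * y ≡ 1 [ZMOD Q] → ∀ j ∈ Finset.range Q,
      ((((((j : ℤ) * x) % (Q : ℤ)).toNat : ℕ) : ℤ) * y % (Q : ℤ)).toNat = j := by
    intro x y hxy j hj
    have hj' := Finset.mem_range.1 hj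
    have h1 : ((j : ℤ) * x) % (Q : ℤ) * y ≡ j [ZMOD Q] := by
      calc ((j : ℤ) * x) % (Q : ℤ) * y ≡ (j * x) * y [ZMOD Q] :=
            (Int.mod_modEq _ _).mul_right _
        _ = j * (x * y) := by ring
        _ ≡ j * 1 [ZMOD Q] := hxy.mul_left _
        _ = j := by ring
    rw [hmod]
    have h2 : ((j : ℤ) * x) % (Q : ℤ) * y % (Q : ℤ) = j := by
      rw [h1.eq]; exact Int.emod_eq_of_lt (by positivity) (by exact_mod_cast hj')
    rw [h2]; simp
  have hpu : p * u ≡ 1 [ZMOD Q] := by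
    rw [← huv]
    exact (Int.modEq_iff_dvd.2 ⟨v, by ring⟩)
  have hmem : ∀ m : ℤ, (m % (Q : ℤ)).toNat ∈ Finset.range Q := by
    intro m
    have h1 := Int.emod_lt_of_pos m (show (0 : ℤ) < Q by positivity)
    have h2 := hmod m
    rw [Finset.mem_range]
    lia
  refine Finset.sum_nbij' (fun j => (((j : ℤ) * p) % (Q : ℤ)).toNat)
    (fun j => (((j : ℤ) * u) % (Q : ℤ)).toNat) (fun _ _ => hmem _) (fun _ _ => hmem _)
    (key p u hpu) (key u p (by rwa [mul_comm])) ?_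
  intro j _
  have h1 := hred ((j : ℤ) * p)
  rw [← hmod] at h1
  rw [← mul_div_assoc]
  push_cast at h1 ⊢
  exact h1

/-- Koksma-type estimate over one denominator `Q` of a rational approximation of `α`. -/
lemma norm_sum_rotation_sub_integral_le {α : ℝ} (β : ℝ) {p : ℤ} {Q : ℕ} (hQ : 0 < Q)
    (hp : IsCoprime p (Q : ℤ)) (happ : |α - (p : ℝ) / Q| ≤ 1 / (Q : ℝ) ^ 2)
    {g : ℝ → ℂ} (hg : Function.Periodic g 1) (hint : ∀ x y, IntervalIntegrable g volume x y)
    {W : ℝ → ℝ} {V : ℝ} (hW : ∀ x, W (x + 1) = W x + V)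
    (hgW : ∀ x y, x ≤ y → ‖g x - g y‖ ≤ W y - W x) :
    ‖∑ j ∈ Finset.range Q, g (β + j * α) - Q * ∫ x in (0 : ℝ)..1, g x‖ ≤ 2 * V := by
  have hQ0 : (0 : ℝ) < Q := by positivity
  have hmono : Monotone W := fun x y hxy => by
    linarith [hgW x y hxy, norm_nonneg (g x - g y)]
  have hsumint : ∑ j ∈ Finset.range Q,
      ∫ x in (β + j * ((p : ℝ) / Q))..(β + j * ((p : ℝ) / Q) + 1 / Q), g x
      = ∫ x in (0 : ℝ)..1, g x := by
    have hper : Function.Periodic (fun c : ℝ => ∫ x in (β + c)..(β + c + 1 / Q), g x) 1 := by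
      intro c
      have : ∫ x in (β + c)..(β + c + 1 / Q), g x =
          ∫ x in (β + c)..(β + c + 1 / Q), g (x + 1) := by
        congr 1; ext x; exact (hg x).symm
      simp only []
      rw [this, intervalIntegral.integral_comp_add_right]
      ring_nf
    rw [sum_periodic_mul_div hper hQ hp]
    have := intervalIntegral.sum_integral_adjacent_intervals (μ := volume) (f := g)
      (a := fun j : ℕ => β + (j : ℝ) / Q) (n := Q) (fun k _ => hint _ _)
    calc _ = ∑ j ∈ Finset.range Q, ∫ x in (β + (j : ℝ) / Q)..(β + ((j + 1 : ℕ) : ℝ) / Q), g x := by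
          refine Finset.sum_congr rfl fun j _ => ?_
          congr 1; push_cast; ring
      _ = _ := this
      _ = ∫ x in β..(β + 1), g x := by
          congr 1
          · simp
          · field_simp
      _ = ∫ x in (0 : ℝ)..(0 + 1), g x := hg.intervalIntegral_add_eq _ _
      _ = _ := by simp
  have hsumW : ∑ j ∈ Finset.range Q, (W (β + j * ((p : ℝ) / Q) + 1 / Q)
      - W (β + j * ((p : ℝ) / Q) - 1 / Q)) = 2 * V := by
    have hper : Function.Periodic (fun c : ℝ => W (β + c + 1 / Q) - W (β + c - 1 / Q)) 1 := by
      intro c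
      have h1 := hW (β + c + 1 / Q)
      have h2 := hW (β + c - 1 / Q)
      have e1 : β + (c + 1) + 1 / Q = β + c + 1 / Q + 1 := by ring
      have e2 : β + (c + 1) - 1 / Q = β + c - 1 / Q + 1 := by ring
      simp only []
      rw [e1, e2, h1, h2]; ring
    rw [sum_periodic_mul_div hper hQ hp]
    have h1 := Finset.sum_range_sub (fun j : ℕ => W (β + (j : ℝ) / Q)) Q
    have h2 := Finset.sum_range_sub (fun j : ℕ => W (β + ((j : ℝ) - 1) / Q)) Q
    have e1 : W (β + (Q : ℝ) / Q) = W β + V := by rw [div_self hQ0.ne', hW]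
    have e2 : W (β + ((Q : ℝ) - 1) / Q) = W (β + ((0 : ℕ) - 1 : ℝ) / Q) + V := by
      rw [← hW]; congr 1; push_cast; field_simp; ring
    simp only [e2] at h2
    simp only [e1] at h1
    simp only [Nat.cast_zero, zero_div, add_zero] at h1
    have : ∑ j ∈ Finset.range Q, (W (β + (j : ℝ) / Q + 1 / Q) - W (β + (j : ℝ) / Q - 1 / Q))
        = ∑ j ∈ Finset.range Q, (W (β + ((j + 1 : ℕ) : ℝ) / Q) - W (β + (j : ℝ) / Q))
        + ∑ j ∈ Finset.range Q, (W (β + (((j + 1 : ℕ) : ℝ) - 1) / Q)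
          - W (β + ((j : ℝ) - 1) / Q)) := by
      rw [← Finset.sum_add_distrib]
      refine Finset.sum_congr rfl fun j _ => ?_
      have a1 : β + (j : ℝ) / Q + 1 / Q = β + ((j + 1 : ℕ) : ℝ) / Q := by push_cast; ring
      have a2 : β + (j : ℝ) / Q - 1 / Q = β + ((j : ℝ) - 1) / Q := by ring
      have a3 : β + (((j + 1 : ℕ) : ℝ) - 1) / Q = β + (j : ℝ) / Q := by push_cast; ring
      rw [a1, a2, a3]; ring
    rw [this, h1, h2]; ring
  rw [← hsumint, ← hsumW, Finset.mul_sum, ← Finset.sum_sub_distrib]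
  refine norm_sum_le_of_le _ fun j hj => ?_
  set c : ℝ := β + j * ((p : ℝ) / Q) with hc
  set D := W (c + 1 / Q) - W (c - 1 / Q) with hD
  have hj' : (j : ℝ) ≤ Q := by exact_mod_cast (Finset.mem_range.1 hj).le
  have hclose : |(β + j * α) - c| ≤ 1 / Q := by
    have : (β + j * α) - c = j * (α - p / Q) := by rw [hc]; ring
    rw [this, abs_mul, Nat.abs_cast]
    calc (j : ℝ) * |α - p / Q| ≤ Q * (1 / (Q : ℝ) ^ 2) := by gcongr
      _ = 1 / Q := by field_simp
  obtain ⟨hc1, hc2⟩ := abs_le.1 hclose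
  have hpos : (0 : ℝ) < 1 / Q := by positivity
  have hbound : ∀ x ∈ Set.uIoc c (c + 1 / Q), ‖g (β + j * α) - g x‖ ≤ D := by
    intro x hx
    rw [Set.uIoc_of_le (by linarith)] at hx
    rcases le_total (β + j * α) x with h | h
    · have h1 := hgW _ _ h
      have h2 := hmono hx.2
      have h3 : W (c - 1 / Q) ≤ W (β + j * α) := hmono (by linarith)
      linarith
    · have h1 := hgW _ _ h
      rw [norm_sub_rev] at h1
      have h2 : W (c - 1 / Q) ≤ W x := hmono (by linarith [hx.1])
      have h3 : W (β + j * α) ≤ W (c + 1 / Q) := hmono (by linarith)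
      linarith
  have h1 := intervalIntegral.norm_integral_le_of_norm_le_const hbound
  rw [intervalIntegral.integral_sub intervalIntegrable_const (hint _ _),
    intervalIntegral.integral_const] at h1
  have h2 : g (β + j * α) - Q * ∫ x in c..(c + 1 / Q), g x
      = Q * ((c + 1 / Q - c : ℝ) • g (β + j * α) - ∫ x in c..(c + 1 / Q), g x) := by
    rw [Complex.real_smul]
    have : (Q : ℂ) ≠ 0 := by exact_mod_cast hQ.ne'
    push_cast
    field_simp
    ring
  rw [h2, norm_mul, Complex.norm_natCast]
  calc _ ≤ (Q : ℝ) * (D * |c + 1 / Q - c|) := by gcongr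
    _ = D := by
      rw [show c + 1 / (Q : ℝ) - c = 1 / Q by ring, abs_of_pos hpos]; field_simp

/-- Badly approximable: approximations with denominator of controlled size. -/
lemma exists_rat_approx_sqrt {k₁ k₂ : ℕ} (hk₂ : 0 < k₂)
    (hirr : Irrational (Real.sqrt ((k₁ : ℝ) / k₂))) :
    ∃ c > 0, ∀ x : ℝ, 1 ≤ x → ∃ (p : ℤ) (Q : ℕ), 0 < Q ∧ IsCoprime p (Q : ℤ) ∧
      |Real.sqrt ((k₁ : ℝ) / k₂) - (p : ℝ) / Q| ≤ 1 / (Q : ℝ) ^ 2 ∧ c * x ≤ Q ∧ (Q : ℝ) ≤ x := by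
  set α := Real.sqrt ((k₁ : ℝ) / k₂) with hα
  have hα0 : 0 ≤ α := Real.sqrt_nonneg _
  have hk₂' : (0 : ℝ) < k₂ := by positivity
  have hsq : α ^ 2 = k₁ / k₂ := Real.sq_sqrt (by positivity)
  refine ⟨1 / (k₂ * (2 * α + 1)), by positivity, fun x hx => ?_⟩
  have hn : 0 < ⌊x⌋₊ := Nat.floor_pos.2 hx
  obtain ⟨r, hr1, hr2⟩ := Real.exists_rat_abs_sub_le_and_den_le α hn
  have hQ : (0 : ℝ) < r.den := by exact_mod_cast r.den_pos
  have hcast : ((r : ℚ) : ℝ) = (r.num : ℝ) / r.den := by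
    exact_mod_cast (Rat.num_div_den r).symm
  rw [hcast] at hr1
  have hxl : x ≤ (⌊x⌋₊ : ℝ) + 1 := (Nat.lt_floor_add_one x).le
  have hden : (r.den : ℝ) ≤ ⌊x⌋₊ := by exact_mod_cast hr2
  have hQ1 : (1 : ℝ) ≤ r.den := by exact_mod_cast r.den_pos
  have happ : |α - (r.num : ℝ) / r.den| ≤ 1 / (r.den : ℝ) ^ 2 := by
    refine hr1.trans ?_
    rw [sq]
    gcongr
    linarith
  refine ⟨r.num, r.den, r.den_pos, ?_, happ, ?_, hden.trans (Nat.floor_le (by linarith))⟩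
  · rw [Int.isCoprime_iff_gcd_eq_one]
    exact r.reduced
  · have hne : (k₂ : ℤ) * r.num ^ 2 - k₁ * (r.den : ℤ) ^ 2 ≠ 0 := by
      intro h
      have h' : (k₂ : ℝ) * r.num ^ 2 - k₁ * (r.den : ℝ) ^ 2 = 0 := by exact_mod_cast h
      have h2 : α ^ 2 = ((r.num : ℝ) / r.den) ^ 2 := by
        rw [hsq]; field_simp; linarith
      rcases sq_eq_sq_iff_eq_or_eq_neg.1 h2 with h3 | h3
      · exact hirr ⟨r, by rw [hcast, h3]⟩
      · exact hirr ⟨-r, by push_cast; rw [hcast, h3]⟩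
    have hone : (1 : ℝ) ≤ |(k₂ : ℝ) * r.num ^ 2 - k₁ * (r.den : ℝ) ^ 2| := by
      exact_mod_cast Int.one_le_abs hne
    have hfac : (k₂ : ℝ) * r.num ^ 2 - k₁ * (r.den : ℝ) ^ 2
        = -(k₂ * (r.den : ℝ) ^ 2) * ((α - r.num / r.den) * (α + r.num / r.den)) := by
      have : (α - r.num / r.den) * (α + r.num / r.den) = k₁ / k₂ - (r.num / r.den : ℝ) ^ 2 := by
        rw [← hsq]; ring
      rw [this]; field_simp; ring
    have hle1 : |α - (r.num : ℝ) / r.den| ≤ 1 := by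
      refine happ.trans ?_
      rw [div_le_one (by positivity)]
      nlinarith
    have hsum : |α + (r.num : ℝ) / r.den| ≤ 2 * α + 1 := by
      rw [abs_le] at hle1 ⊢
      constructor <;> linarith [hle1.1, hle1.2]
    rw [hfac, abs_mul, abs_mul, abs_neg, abs_of_pos (by positivity)] at hone
    have h5 : 1 ≤ k₂ * (r.den : ℝ) ^ 2 * (1 / ((⌊x⌋₊ + 1) * r.den) * (2 * α + 1)) := by
      refine hone.trans ?_
      gcongr
    have h6 : k₂ * (r.den : ℝ) ^ 2 * (1 / ((⌊x⌋₊ + 1) * r.den) * (2 * α + 1))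
        = r.den * (k₂ * (2 * α + 1)) / (⌊x⌋₊ + 1) := by field_simp
    rw [h6, le_div_iff₀ (by positivity)] at h5
    rw [one_div_mul_eq_div, div_le_iff₀ (by positivity)]
    linarith

/-- The arithmetic phase `e((a/q) r s + (b/(2qk₂))(k₁ r² + k₂ s²))`. -/
noncomputable def arithPhase (k₁ k₂ : ℕ) (a b : ℤ) (q : ℕ) (r s : ℤ) : ℂ :=
  expc ((a : ℝ) / q * r * s +
    (b : ℝ) / (2 * q * k₂) * ((k₁ : ℝ) * (r : ℝ) ^ 2 + (k₂ : ℝ) * (s : ℝ) ^ 2))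

/-- The phase `e(((a+b√k)/q) n⌊n√k⌋)` as a function of `r = n` and `y = n√k`. -/
noncomputable def beattyPhase (k₁ k₂ : ℕ) (a b : ℤ) (q : ℕ) (r : ℤ) (y : ℝ) : ℂ :=
  arithPhase k₁ k₂ a b q r ⌊y⌋ * expc (-((b : ℝ) / (2 * q) * Int.fract y ^ 2))

lemma norm_arithPhase (k₁ k₂ : ℕ) (a b : ℤ) (q : ℕ) (r s : ℤ) :
    ‖arithPhase k₁ k₂ a b q r s‖ = 1 := norm_expc _

lemma arithPhase_add_left {k₁ k₂ : ℕ} (hk₂ : 0 < k₂) (a b : ℤ) {q : ℕ} (hq : 0 < q) (r s : ℤ) :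
    arithPhase k₁ k₂ a b q (r + (2 * q * k₂ : ℕ)) s = arithPhase k₁ k₂ a b q r s := by
  refine expc_eq_of_sub_eq_intCast (2 * k₂ * a * s + b * k₁ * (2 * r + (2 * q * k₂ : ℕ))) ?_
  push_cast
  field_simp
  ring

lemma arithPhase_add_right {k₁ k₂ : ℕ} (hk₂ : 0 < k₂) (a b : ℤ) {q : ℕ} (hq : 0 < q) (r s : ℤ) :
    arithPhase k₁ k₂ a b q r (s + (2 * q * k₂ : ℕ)) = arithPhase k₁ k₂ a b q r s := by
  refine expc_eq_of_sub_eq_intCast (2 * k₂ * a * r + b * k₂ * (2 * s + (2 * q * k₂ : ℕ))) ?_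
  push_cast
  field_simp
  ring

lemma norm_beattyPhase (k₁ k₂ : ℕ) (a b : ℤ) (q : ℕ) (r : ℤ) (y : ℝ) :
    ‖beattyPhase k₁ k₂ a b q r y‖ = 1 := by
  rw [beattyPhase, norm_mul, norm_arithPhase, norm_expc, one_mul]

lemma beattyPhase_add_left {k₁ k₂ : ℕ} (hk₂ : 0 < k₂) (a b : ℤ) {q : ℕ} (hq : 0 < q) (r : ℤ)
    (y : ℝ) :
    beattyPhase k₁ k₂ a b q (r + (2 * q * k₂ : ℕ)) y = beattyPhase k₁ k₂ a b q r y := by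
  rw [beattyPhase, beattyPhase, arithPhase_add_left hk₂ a b hq]

lemma beattyPhase_add_mul_left {k₁ k₂ : ℕ} (hk₂ : 0 < k₂) (a b : ℤ) {q : ℕ} (hq : 0 < q) (r : ℤ)
    (j : ℕ) (y : ℝ) :
    beattyPhase k₁ k₂ a b q (r + (2 * q * k₂ : ℕ) * j) y = beattyPhase k₁ k₂ a b q r y := by
  induction j with
  | zero => simp
  | succ j ih =>
    have h := beattyPhase_add_left (k₁ := k₁) hk₂ a b hq (r + (2 * q * k₂ : ℕ) * j) y
    rw [← ih, ← h]
    push_cast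
    ring_nf

lemma beattyPhase_add_right {k₁ k₂ : ℕ} (hk₂ : 0 < k₂) (a b : ℤ) {q : ℕ} (hq : 0 < q) (r : ℤ)
    (y : ℝ) :
    beattyPhase k₁ k₂ a b q r (y + (2 * q * k₂ : ℕ)) = beattyPhase k₁ k₂ a b q r y := by
  rw [beattyPhase, beattyPhase, Int.floor_add_natCast, Int.fract_add_natCast,
    arithPhase_add_right hk₂ a b hq]

lemma norm_beattyPhase_sub_le (k₁ k₂ : ℕ) (a b : ℤ) {q : ℕ} (hq : 0 < q) (r : ℤ) {x y : ℝ}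
    (hxy : x ≤ y) :
    ‖beattyPhase k₁ k₂ a b q r x - beattyPhase k₁ k₂ a b q r y‖ ≤
      2 * ((⌊y⌋ : ℝ) - ⌊x⌋) + 2 * Real.pi * |(b : ℝ)| / q * (y - x) := by
  have hL : 0 ≤ 2 * Real.pi * |(b : ℝ)| / q * (y - x) :=
    mul_nonneg (by positivity) (by linarith)
  have hq' : (0 : ℝ) < q := by positivity
  rcases (Int.floor_mono hxy).eq_or_lt with h | h
  · have hb : beattyPhase k₁ k₂ a b q r x - beattyPhase k₁ k₂ a b q r y =
        arithPhase k₁ k₂ a b q r ⌊x⌋ * (expc (-((b : ℝ) / (2 * q) * Int.fract x ^ 2))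
          - expc (-((b : ℝ) / (2 * q) * Int.fract y ^ 2))) := by
      rw [beattyPhase, beattyPhase, ← h]; ring
    rw [hb, norm_mul, norm_arithPhase, one_mul, h, sub_self, mul_zero, zero_add]
    refine (norm_expc_sub_expc_le _ _).trans ?_
    have h1 : -((b : ℝ) / (2 * q) * Int.fract x ^ 2) - -((b : ℝ) / (2 * q) * Int.fract y ^ 2)
        = b / (2 * q) * ((Int.fract x + Int.fract y) * (y - x)) := by
      have : y - x = Int.fract y - Int.fract x := by
        rw [Int.fract, Int.fract, h]; ring
      rw [this]; ring
    have h2 : |(Int.fract x + Int.fract y) * (y - x)| ≤ 2 * (y - x) := by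
      have := Int.fract_nonneg x
      have := Int.fract_nonneg y
      rw [abs_mul, abs_of_nonneg (by linarith : 0 ≤ y - x), abs_of_nonneg (by linarith)]
      have := Int.fract_lt_one x
      have := Int.fract_lt_one y
      gcongr
      linarith
    rw [h1, abs_mul, abs_div, abs_of_pos (by positivity : (0 : ℝ) < 2 * q)]
    calc 2 * Real.pi * (|(b : ℝ)| / (2 * q) * |(Int.fract x + Int.fract y) * (y - x)|)
        ≤ 2 * Real.pi * (|(b : ℝ)| / (2 * q) * (2 * (y - x))) := by gcongr
      _ = _ := by field_simp
  · have h1 : (⌊x⌋ : ℝ) + 1 ≤ ⌊y⌋ := by exact_mod_cast h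
    have h2 := norm_sub_le (beattyPhase k₁ k₂ a b q r x) (beattyPhase k₁ k₂ a b q r y)
    rw [norm_beattyPhase, norm_beattyPhase] at h2
    linarith

lemma measurable_beattyPhase (k₁ k₂ : ℕ) (a b : ℤ) (q : ℕ) (r : ℤ) :
    Measurable (beattyPhase k₁ k₂ a b q r) := by
  have h1 : Measurable fun y : ℝ => arithPhase k₁ k₂ a b q r ⌊y⌋ :=
    (measurable_from_top (f := arithPhase k₁ k₂ a b q r)).comp Int.measurable_floor
  have h2 : Measurable fun y : ℝ => expc (-((b : ℝ) / (2 * q) * Int.fract y ^ 2)) :=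
    continuous_expc.measurable.comp ((measurable_fract.pow_const 2).const_mul _).neg
  exact h1.mul h2

lemma intervalIntegrable_of_norm_le_one {g : ℝ → ℂ} (hg : Measurable g) (h : ∀ x, ‖g x‖ ≤ 1)
    (x y : ℝ) : IntervalIntegrable g volume x y :=
  (intervalIntegrable_const (c := (1 : ℝ))).mono_fun hg.aestronglyMeasurable
    (Filter.Eventually.of_forall fun z => by simpa using h z)

lemma integral_beattyPhase (k₁ k₂ : ℕ) (a b : ℤ) (q : ℕ) (r : ℤ) (M : ℕ) :
    ∫ y in (0 : ℝ)..M, beattyPhase k₁ k₂ a b q r y =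
      (∑ s ∈ Finset.range M, arithPhase k₁ k₂ a b q r s) * Ffactor ((b : ℝ) / (2 * q)) := by
  have h := intervalIntegral.sum_integral_adjacent_intervals (μ := volume)
    (f := beattyPhase k₁ k₂ a b q r) (a := fun j : ℕ => (j : ℝ)) (n := M) (fun k _ =>
      intervalIntegrable_of_norm_le_one (measurable_beattyPhase k₁ k₂ a b q r)
        (fun x => (norm_beattyPhase _ _ _ _ _ _ _).le) _ _)
  rw [Nat.cast_zero] at h
  rw [← h, Finset.sum_mul]
  refine Finset.sum_congr rfl fun s _ => ?_
  have h1 : ∫ y in (s : ℝ)..((s + 1 : ℕ) : ℝ), beattyPhase k₁ k₂ a b q r y =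
      ∫ x in (0 : ℝ)..1, beattyPhase k₁ k₂ a b q r (x + s) := by
    rw [intervalIntegral.integral_comp_add_right]
    push_cast
    ring_nf
  rw [h1, Ffactor, ← intervalIntegral.integral_const_mul]
  refine intervalIntegral.integral_congr_ae ?_
  have : ∀ᵐ x : ℝ ∂volume, x ≠ 1 := by simp [ae_iff]
  filter_upwards [this] with x hx1 hx
  rw [Set.uIoc_of_le zero_le_one] at hx
  have hlt : x < 1 := lt_of_le_of_ne hx.2 hx1
  have hfl : ⌊x⌋ = 0 := Int.floor_eq_zero_iff.2 ⟨hx.1.le, hlt⟩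
  rw [beattyPhase, Int.floor_add_natCast, Int.fract_add_natCast, hfl,
    Int.fract_eq_self.2 ⟨hx.1.le, hlt⟩, zero_add]

lemma expc_eq_beattyPhase {k₁ k₂ : ℕ} (hk₂ : 0 < k₂) (a b : ℤ) {q : ℕ} (hq : 0 < q) (n : ℕ) :
    expc (((a : ℝ) + (b : ℝ) * Real.sqrt ((k₁ : ℝ) / k₂)) / q *
      ((n : ℝ) * (⌊(n : ℝ) * Real.sqrt ((k₁ : ℝ) / k₂)⌋ : ℝ))) =
    beattyPhase k₁ k₂ a b q n (n * Real.sqrt ((k₁ : ℝ) / k₂)) := by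
  have hsq : Real.sqrt ((k₁ : ℝ) / k₂) ^ 2 = k₁ / k₂ := Real.sq_sqrt (by positivity)
  set α := Real.sqrt ((k₁ : ℝ) / k₂)
  have hk : (k₁ : ℝ) = k₂ * α ^ 2 := by rw [hsq]; field_simp
  rw [beattyPhase, arithPhase, ← expc_add, Int.fract]
  congr 1
  rw [hk]
  push_cast
  field_simp
  ring

lemma sum_range_add_of_periodic {E : Type*} [AddCommGroup E] {f : ℕ → E} {M : ℕ}
    (hf : ∀ n, f (n + M) = f n) (c : ℕ) :
    ∑ i ∈ Finset.range M, f (c + i) = ∑ i ∈ Finset.range M, f i := by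
  induction c with
  | zero => simp
  | succ c ih =>
    rw [← ih]
    have h1 := Finset.sum_range_succ (fun i => f (c + i)) M
    have h2 := Finset.sum_range_succ' (fun i => f (c + i)) M
    rw [h1, hf c, add_zero] at h2
    rw [add_right_cancel h2]
    exact Finset.sum_congr rfl fun i _ => by congr 1; ring

lemma sum_range_mul_eq {E : Type*} [AddCommMonoid E] (f : ℕ → E) (M Q : ℕ) :
    ∑ i ∈ Finset.range (M * Q), f i =
      ∑ r ∈ Finset.range M, ∑ j ∈ Finset.range Q, f (r + M * j) := by
  rw [Finset.sum_comm]
  induction Q with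
  | zero => simp
  | succ Q ih =>
    rw [Nat.mul_succ, Finset.sum_range_add, ih, Finset.sum_range_succ]
    congr 1
    exact Finset.sum_congr rfl fun i _ => by rw [add_comm]

lemma sum_Icc_one_eq_sum_range {E : Type*} [AddCommMonoid E] (f : ℕ → E) (n : ℕ) :
    ∑ i ∈ Finset.Icc 1 n, f i = ∑ i ∈ Finset.range n, f (i + 1) := by
  rw [Finset.sum_bij' (fun i _ => i - 1) (fun i _ => i + 1)]
  all_goals grind

lemma sum_arithPhase_eq_Gfactor {k₁ k₂ : ℕ} (hk₂ : 0 < k₂) (a b : ℤ) {q : ℕ} (hq : 0 < q)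
    (n₀ : ℕ) :
    ∑ r ∈ Finset.range (2 * q * k₂), ∑ s ∈ Finset.range (2 * q * k₂),
      arithPhase k₁ k₂ a b q ((n₀ : ℤ) + r) s =
      (((2 * q * k₂ : ℕ) : ℂ) ^ 2) * Gfactor k₁ k₂ a b q := by
  have hM : (((2 * q * k₂ : ℕ) : ℂ)) ≠ 0 := by
    have : 2 * q * k₂ ≠ 0 := by positivity
    exact_mod_cast this
  have hG : (((2 * q * k₂ : ℕ) : ℂ) ^ 2) * Gfactor k₁ k₂ a b q =
      ∑ r ∈ Finset.Icc 1 (2 * q * k₂), ∑ s ∈ Finset.Icc 1 (2 * q * k₂),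
        arithPhase k₁ k₂ a b q (r : ℕ) (s : ℕ) := by
    rw [Gfactor, mul_inv_cancel_left₀ (pow_ne_zero 2 hM)]
    simp only [arithPhase, Int.cast_natCast]
  rw [hG]
  have hs : ∀ r : ℤ, ∑ s ∈ Finset.Icc 1 (2 * q * k₂), arithPhase k₁ k₂ a b q r (s : ℕ) =
      ∑ s ∈ Finset.range (2 * q * k₂), arithPhase k₁ k₂ a b q r (s : ℕ) := by
    intro r
    rw [sum_Icc_one_eq_sum_range]
    have := sum_range_add_of_periodic (f := fun s : ℕ => arithPhase k₁ k₂ a b q r s)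
      (M := 2 * q * k₂) (fun s => by
        have := arithPhase_add_right (k₁ := k₁) hk₂ a b hq r s
        simpa using this) 1
    rw [← this]
    exact Finset.sum_congr rfl fun i _ => by rw [add_comm]
  simp only [hs]
  rw [sum_Icc_one_eq_sum_range]
  have hper := sum_range_add_of_periodic
      (f := fun r : ℕ => ∑ s ∈ Finset.range (2 * q * k₂), arithPhase k₁ k₂ a b q r (s : ℕ))
      (M := 2 * q * k₂) (fun r => Finset.sum_congr rfl fun s _ => by
        have := arithPhase_add_left (k₁ := k₁) hk₂ a b hq r s
        simpa using this)
  have h1 := hper 1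
  have h2 := hper n₀
  calc _ = _ := by push_cast at h2 ⊢; exact h2
    _ = _ := h1.symm
    _ = _ := Finset.sum_congr rfl fun i _ => by rw [add_comm]

/-- Equidistribution of `(n, n√k)` along a block of length `2qk₂Q`. -/
lemma norm_sum_beattyPhase_block_le {k₁ k₂ : ℕ} (hk₂ : 0 < k₂) (a b : ℤ) {q : ℕ} (hq : 0 < q)
    {α : ℝ} {p : ℤ} {Q : ℕ} (hQ : 0 < Q)
    (hp : IsCoprime p (Q : ℤ)) (happ : |α - (p : ℝ) / Q| ≤ 1 / (Q : ℝ) ^ 2) (n₀ : ℕ) :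
    ‖∑ i ∈ Finset.range (2 * q * k₂ * Q),
        beattyPhase k₁ k₂ a b q ((n₀ + i : ℕ) : ℤ) ((n₀ + i : ℕ) * α)
      - ((2 * q * k₂ * Q : ℕ) : ℂ) * (Gfactor k₁ k₂ a b q * Ffactor ((b : ℝ) / (2 * q)))‖ ≤
    16 * ((2 * q * k₂ : ℕ) : ℝ) ^ 2 * (1 + |(b : ℝ)|) := by
  set M := 2 * q * k₂ with hMdef
  have hMpos : 0 < M := by positivity
  have hM0 : (0 : ℝ) < M := by positivity
  have hMC : (M : ℂ) ≠ 0 := by exact_mod_cast hMpos.ne'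
  set L := 2 * Real.pi * |(b : ℝ)| / q with hL
  have hmain : ∀ r ∈ Finset.range M,
      ‖∑ j ∈ Finset.range Q, beattyPhase k₁ k₂ a b q ((n₀ + (r + M * j) : ℕ) : ℤ)
          ((n₀ + (r + M * j) : ℕ) * α)
        - Q * ((M : ℂ)⁻¹ * ((∑ s ∈ Finset.range M, arithPhase k₁ k₂ a b q ((n₀ : ℤ) + r) s) *
          Ffactor ((b : ℝ) / (2 * q))))‖ ≤ 2 * (2 * M + L * M) := by
    intro r _
    have hmeas : Measurable fun x : ℝ => beattyPhase k₁ k₂ a b q ((n₀ : ℤ) + r) (M * x) :=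
      (measurable_beattyPhase k₁ k₂ a b q _).comp (measurable_const_mul _)
    have h := norm_sum_rotation_sub_integral_le (((n₀ : ℝ) + r) * α / M) hQ hp happ
      (g := fun x : ℝ => beattyPhase k₁ k₂ a b q ((n₀ : ℤ) + r) (M * x))
      (W := fun x => 2 * (⌊(M : ℝ) * x⌋ : ℝ) + L * (M * x)) (V := 2 * M + L * M)
      (fun x => by
        simp only []
        rw [mul_add, mul_one]
        exact beattyPhase_add_right hk₂ a b hq _ _)
      (intervalIntegrable_of_norm_le_one hmeas fun x => (norm_beattyPhase _ _ _ _ _ _ _).le)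
      (fun x => by
        rw [mul_add, mul_one, Int.floor_add_natCast]
        push_cast
        ring)
      (fun x y hxy => by
        have h1 := norm_beattyPhase_sub_le k₁ k₂ a b hq ((n₀ : ℤ) + r)
          (mul_le_mul_of_nonneg_left hxy hM0.le)
        refine h1.trans (le_of_eq ?_)
        rw [hL]; ring)
    have hI : ∫ x in (0 : ℝ)..1, beattyPhase k₁ k₂ a b q ((n₀ : ℤ) + r) (M * x) =
        (M : ℂ)⁻¹ * ((∑ s ∈ Finset.range M, arithPhase k₁ k₂ a b q ((n₀ : ℤ) + r) s) *
          Ffactor ((b : ℝ) / (2 * q))) := by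
      rw [intervalIntegral.integral_comp_mul_left _ hM0.ne', mul_zero, mul_one,
        integral_beattyPhase, Complex.real_smul]
      push_cast
      rfl
    rw [hI] at h
    have hsum : ∑ j ∈ Finset.range Q, beattyPhase k₁ k₂ a b q ((n₀ + (r + M * j) : ℕ) : ℤ)
          ((n₀ + (r + M * j) : ℕ) * α) = ∑ j ∈ Finset.range Q,
        beattyPhase k₁ k₂ a b q ((n₀ : ℤ) + r) (M * (((n₀ : ℝ) + r) * α / M + j * α)) := by
      refine Finset.sum_congr rfl fun j _ => ?_
      have e1 : (M : ℝ) * (((n₀ : ℝ) + r) * α / M + j * α) = (n₀ + (r + M * j) : ℕ) * α := by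
        push_cast; field_simp; ring
      have e2 : ((n₀ + (r + M * j) : ℕ) : ℤ) = ((n₀ : ℤ) + r) + (2 * q * k₂ : ℕ) * j := by
        rw [← hMdef]; push_cast; ring
      rw [e1, e2, beattyPhase_add_mul_left hk₂ a b hq]
    rw [hsum]
    exact h
  rw [sum_range_mul_eq (fun i => beattyPhase k₁ k₂ a b q ((n₀ + i : ℕ) : ℤ) ((n₀ + i : ℕ) * α))]
  have hz : ((M * Q : ℕ) : ℂ) * (Gfactor k₁ k₂ a b q * Ffactor ((b : ℝ) / (2 * q))) =
      ∑ r ∈ Finset.range M, Q * ((M : ℂ)⁻¹ *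
        ((∑ s ∈ Finset.range M, arithPhase k₁ k₂ a b q ((n₀ : ℤ) + r) s) *
          Ffactor ((b : ℝ) / (2 * q)))) := by
    rw [← Finset.mul_sum, ← Finset.mul_sum, ← Finset.sum_mul,
      sum_arithPhase_eq_Gfactor hk₂ a b hq, ← hMdef]
    push_cast
    field_simp
  rw [hz, ← Finset.sum_sub_distrib]
  refine (norm_sum_le_of_le _ hmain).trans ?_
  rw [Finset.sum_const, Finset.card_range, nsmul_eq_mul]
  have hLle : L ≤ 6.3 * |(b : ℝ)| := by
    rw [hL]
    have hq1 : (1 : ℝ) ≤ q := by exact_mod_cast hq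
    refine (div_le_self (by positivity) hq1).trans ?_
    have := Real.pi_lt_d2
    gcongr
    linarith
  have : 2 + L ≤ 8 * (1 + |(b : ℝ)|) := by linarith [abs_nonneg (b : ℝ)]
  calc (M : ℝ) * (2 * (2 * M + L * M)) = 2 * (M : ℝ) ^ 2 * (2 + L) := by ring
    _ ≤ 2 * (M : ℝ) ^ 2 * (8 * (1 + |(b : ℝ)|)) := by gcongr
    _ = _ := by ring

/-- Partial summation against a slowly varying weight, block by block. -/
lemma norm_sum_mul_sub_integral_le {u w : ℕ → ℂ} {v : ℝ → ℂ} {z : ℂ} {B n : ℕ} {E₀ η : ℝ}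
    (hB : 0 < B) (hu : ∀ i, ‖u i‖ ≤ 1) (hw : ∀ i, ‖w i‖ ≤ 1) (hv : ∀ x, ‖v x‖ ≤ 1)
    (hvc : Continuous v) (hz : ‖z‖ ≤ 1) (hE₀ : 0 ≤ E₀) (hη : 0 ≤ η)
    (hblock : ∀ n₀, ‖∑ i ∈ Finset.range B, u (n₀ + i) - B * z‖ ≤ E₀)
    (hwv : ∀ n₀ i, i < B → n₀ + B ≤ n → ‖w (n₀ + i) - v n₀‖ ≤ η)
    (hvv : ∀ (n₀ : ℕ) (x : ℝ), n₀ ≤ x → x ≤ n₀ + B → n₀ + B ≤ n → ‖v x - v n₀‖ ≤ η) :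
    ‖∑ i ∈ Finset.range n, u i * w i - z * ∫ x in (0 : ℝ)..n, v x‖ ≤
      n / B * (E₀ + 2 * B * η) + 2 * B := by
  have hvi : ∀ x y : ℝ, IntervalIntegrable v volume x y := fun x y => hvc.intervalIntegrable x y
  have hone : ∀ n₀ : ℕ, n₀ + B ≤ n →
      ‖∑ i ∈ Finset.range B, u (n₀ + i) * w (n₀ + i) - z * ∫ x in (n₀ : ℝ)..(n₀ + B : ℝ), v x‖
        ≤ E₀ + 2 * B * η := by
    intro n₀ hn₀
    have h1 : ‖∑ i ∈ Finset.range B, u (n₀ + i) * (w (n₀ + i) - v n₀)‖ ≤ B * η := by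
      have : ∀ i ∈ Finset.range B, ‖u (n₀ + i) * (w (n₀ + i) - v n₀)‖ ≤ η := by
        intro i hi
        rw [norm_mul]
        exact (mul_le_of_le_one_left (norm_nonneg _) (hu _)).trans
          (hwv n₀ i (Finset.mem_range.1 hi) hn₀)
      refine (norm_sum_le_of_le _ this).trans ?_
      rw [Finset.sum_const, Finset.card_range, nsmul_eq_mul]
    have h2 : ‖(∑ i ∈ Finset.range B, u (n₀ + i) - B * z) * v n₀‖ ≤ E₀ := by
      rw [norm_mul]
      exact (mul_le_of_le_one_right (norm_nonneg _) (hv _)).trans (hblock n₀)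
    have h3 : ‖z * ∫ x in (n₀ : ℝ)..(n₀ + B : ℝ), (v x - v n₀)‖ ≤ B * η := by
      rw [norm_mul]
      refine (mul_le_of_le_one_left (norm_nonneg _) hz).trans ?_
      have := intervalIntegral.norm_integral_le_of_norm_le_const (a := (n₀ : ℝ))
        (b := (n₀ + B : ℝ)) (f := fun x => v x - v n₀) (C := η) (fun x hx => by
          rw [Set.uIoc_of_le (by simp)] at hx
          exact hvv n₀ x hx.1.le hx.2 hn₀)
      refine this.trans (le_of_eq ?_)
      rw [add_sub_cancel_left, Nat.abs_cast, mul_comm]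
    have h4 : ∫ x in (n₀ : ℝ)..(n₀ + B : ℝ), (v x - v n₀) =
        (∫ x in (n₀ : ℝ)..(n₀ + B : ℝ), v x) - B * v n₀ := by
      rw [intervalIntegral.integral_sub (hvi _ _) intervalIntegrable_const,
        intervalIntegral.integral_const, Complex.real_smul]
      push_cast
      ring
    have h5 : ∑ i ∈ Finset.range B, u (n₀ + i) * w (n₀ + i)
        - z * ∫ x in (n₀ : ℝ)..(n₀ + B : ℝ), v x =
        ∑ i ∈ Finset.range B, u (n₀ + i) * (w (n₀ + i) - v n₀)
        + (∑ i ∈ Finset.range B, u (n₀ + i) - B * z) * v n₀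
        - z * ∫ x in (n₀ : ℝ)..(n₀ + B : ℝ), (v x - v n₀) := by
      rw [h4]
      simp only [mul_sub, Finset.sum_sub_distrib, ← Finset.sum_mul]
      ring
    rw [h5]
    refine (norm_sub_le _ _).trans ?_
    have := norm_add_le (∑ i ∈ Finset.range B, u (n₀ + i) * (w (n₀ + i) - v n₀))
      ((∑ i ∈ Finset.range B, u (n₀ + i) - B * z) * v n₀)
    linarith
  have hind : ∀ K : ℕ, B * K ≤ n →
      ‖∑ i ∈ Finset.range (B * K), u i * w i - z * ∫ x in (0 : ℝ)..(B * K : ℕ), v x‖ ≤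
        K * (E₀ + 2 * B * η) := by
    intro K
    induction K with
    | zero => simp
    | succ K ih =>
      intro hK
      rw [Nat.mul_succ] at hK ⊢
      have h1 := ih (by lia)
      have h2 := hone (B * K) hK
      have h3 := intervalIntegral.integral_add_adjacent_intervals (hvi 0 (B * K : ℕ))
        (hvi (B * K : ℕ) ((B * K : ℕ) + B : ℝ))
      rw [Finset.sum_range_add, Nat.cast_add (B * K) B, ← h3]
      have h4 := norm_add_le_of_le h1 h2
      push_cast at h4 ⊢
      calc _ ≤ _ := le_of_eq (by congr 1; ring)
        _ ≤ _ := h4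
        _ = _ := by ring
  set K := n / B
  have hn : B * K + n % B = n := Nat.div_add_mod n B
  have hR : n % B < B := Nat.mod_lt _ hB
  have h1 := hind K (Nat.mul_div_le n B)
  have h2 : ‖∑ i ∈ Finset.range (n % B), u (B * K + i) * w (B * K + i)‖ ≤ B := by
    have : ∀ i ∈ Finset.range (n % B), ‖u (B * K + i) * w (B * K + i)‖ ≤ 1 := by
      intro i _
      rw [norm_mul]
      exact mul_le_one₀ (hu _) (norm_nonneg _) (hw _)
    refine (norm_sum_le_of_le _ this).trans ?_
    rw [Finset.sum_const, Finset.card_range, nsmul_eq_mul, mul_one]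
    exact_mod_cast hR.le
  have h3 : ‖z * ∫ x in ((B * K : ℕ) : ℝ)..n, v x‖ ≤ B := by
    rw [norm_mul]
    refine (mul_le_of_le_one_left (norm_nonneg _) hz).trans ?_
    refine (intervalIntegral.norm_integral_le_of_norm_le_const (C := 1) fun x _ => hv x).trans ?_
    have : (n : ℝ) - (B * K : ℕ) = (n % B : ℕ) := by
      rw [sub_eq_iff_eq_add]
      exact_mod_cast (by lia : n = n % B + B * K)
    rw [this, Nat.abs_cast, one_mul]
    exact_mod_cast hR.le
  have h4 := intervalIntegral.integral_add_adjacent_intervals (hvi 0 (B * K : ℕ))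
    (hvi (B * K : ℕ) n)
  have h5 : ∑ i ∈ Finset.range n, u i * w i = ∑ i ∈ Finset.range (B * K), u i * w i
      + ∑ i ∈ Finset.range (n % B), u (B * K + i) * w (B * K + i) := by
    rw [← Finset.sum_range_add, hn]
  have hK : (K : ℝ) ≤ n / B := Nat.cast_div_le
  have h6 : (K : ℝ) * (E₀ + 2 * B * η) ≤ n / B * (E₀ + 2 * B * η) := by gcongr
  rw [h5, ← h4]
  have h7 := norm_add_le_of_le h1 (norm_sub_le_of_le h2 h3)
  calc _ ≤ _ := le_of_eq (by congr 1; ring)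
    _ ≤ _ := h7
    _ ≤ _ := by linarith

lemma norm_Gfactor_le_one (k₁ k₂ : ℕ) (a b : ℤ) (q : ℕ) : ‖Gfactor k₁ k₂ a b q‖ ≤ 1 := by
  rw [Gfactor, norm_mul, norm_inv, norm_pow, Complex.norm_natCast]
  set M := 2 * q * k₂
  have : ‖∑ r ∈ Finset.Icc 1 M, ∑ s ∈ Finset.Icc 1 M,
      expc ((a : ℝ) / q * r * s +
        (b : ℝ) / (2 * q * k₂) * ((k₁ : ℝ) * (r : ℝ) ^ 2 + (k₂ : ℝ) * (s : ℝ) ^ 2))‖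
      ≤ (M : ℝ) ^ 2 := by
    refine (norm_sum_le_of_le _ fun r _ => norm_sum_le_of_le _ fun s _ =>
      (norm_expc _).le).trans (le_of_eq ?_)
    simp [sq]
  exact inv_mul_le_one_of_le₀ this (by positivity)

lemma norm_Ffactor_le_one (ξ : ℝ) : ‖Ffactor ξ‖ ≤ 1 := by
  have := intervalIntegral.norm_integral_le_of_norm_le_const (a := (0 : ℝ)) (b := 1) (C := 1)
    (f := fun x => expc (-(ξ * x ^ 2))) fun x _ => (norm_expc _).le
  simpa [Ffactor] using this

/-- Replacing the normalisation by `⌊N⌋` with the one by `N` costs `O(1/N)`. -/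
lemma norm_average_sub_average_le {S z : ℂ} {v : ℝ → ℂ} {N X : ℝ} {n : ℕ} (hn : 0 < n)
    (hnN : n ≤ N) (hNn : N ≤ n + 1) (hvc : Continuous v) (hv : ∀ x, ‖v x‖ ≤ 1) (hz : ‖z‖ ≤ 1)
    (h : ‖S - z * ∫ x in (0 : ℝ)..n, v x‖ ≤ X) :
    ‖(n : ℂ)⁻¹ * S - z * ((N : ℂ)⁻¹ * ∫ x in (0 : ℝ)..N, v x)‖ ≤ X / n + 2 / N := by
  have hn0 : (0 : ℝ) < n := by positivity
  have hN0 : 0 < N := by linarith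
  have hnC : (n : ℂ) ≠ 0 := by exact_mod_cast hn.ne'
  have hNC : (N : ℂ) ≠ 0 := by exact_mod_cast hN0.ne'
  have hadd := intervalIntegral.integral_add_adjacent_intervals
    (hvc.intervalIntegrable (μ := volume) 0 n) (hvc.intervalIntegrable (μ := volume) n N)
  set I := ∫ x in (0 : ℝ)..n, v x
  set J := ∫ x in (n : ℝ)..N, v x
  have hI : ‖I‖ ≤ n := by
    have := intervalIntegral.norm_integral_le_of_norm_le_const (a := (0 : ℝ)) (b := n) (C := 1)
      (f := v) fun x _ => hv x
    simpa using this
  have hJ : ‖J‖ ≤ 1 := by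
    have := intervalIntegral.norm_integral_le_of_norm_le_const (a := (n : ℝ)) (b := N) (C := 1)
      (f := v) fun x _ => hv x
    rw [one_mul, abs_of_nonneg (by linarith)] at this
    linarith
  have e : (n : ℂ)⁻¹ * S - z * ((N : ℂ)⁻¹ * ∫ x in (0 : ℝ)..N, v x) =
      (n : ℂ)⁻¹ * (S - z * I) + z * ((((N - n : ℝ) : ℂ) * ((n : ℂ)⁻¹ * (N : ℂ)⁻¹)) * I
        - (N : ℂ)⁻¹ * J) := by
    rw [← hadd]
    push_cast
    field_simp
    ring
  rw [e]
  have h1 : ‖(n : ℂ)⁻¹ * (S - z * I)‖ ≤ X / n := by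
    rw [norm_mul, norm_inv, Complex.norm_natCast, inv_mul_eq_div]
    gcongr
  have h2 : ‖(((N - n : ℝ) : ℂ) * ((n : ℂ)⁻¹ * (N : ℂ)⁻¹)) * I‖ ≤ 1 / N := by
    rw [norm_mul, norm_mul, norm_mul, norm_inv, norm_inv, Complex.norm_natCast, Complex.norm_real,
      Complex.norm_real, Real.norm_of_nonneg (by linarith), Real.norm_of_nonneg hN0.le]
    calc (N - n) * ((n : ℝ)⁻¹ * N⁻¹) * ‖I‖ ≤ 1 * ((n : ℝ)⁻¹ * N⁻¹) * n := by
          gcongr; linarith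
      _ = 1 / N := by field_simp
  have h3 : ‖(N : ℂ)⁻¹ * J‖ ≤ 1 / N := by
    rw [norm_mul, norm_inv, Complex.norm_real, Real.norm_of_nonneg hN0.le, inv_mul_eq_div]
    gcongr
  have h4 := norm_add_le_of_le h1 ((norm_mul_le z _).trans
    ((mul_le_of_le_one_left (norm_nonneg _) hz).trans (norm_sub_le_of_le h2 h3)))
  refine h4.trans (le_of_eq ?_)
  ring

/-- The estimate before optimising the denominator `Q`. -/
lemma norm_average_sub_le_of_rat_approx {k₁ k₂ : ℕ} (hk₂ : 0 < k₂) (a b : ℤ) {q : ℕ} (hq : 0 < q)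
    {α : ℝ} (hα : α = Real.sqrt ((k₁ : ℝ) / k₂)) {p : ℤ} {Q : ℕ} (hQ : 0 < Q)
    (hp : IsCoprime p (Q : ℤ)) (happ : |α - (p : ℝ) / Q| ≤ 1 / (Q : ℝ) ^ 2) {N : ℝ} {n : ℕ}
    (hn : 0 < n) (hnN : n ≤ N) (hNn : N ≤ n + 1) (t : ℝ) :
    ‖(n : ℂ)⁻¹ * (∑ m ∈ Finset.Icc 1 n, expc ((((a : ℝ) + (b : ℝ) * α) / q + t) *
          ((m : ℝ) * (⌊(m : ℝ) * α⌋ : ℝ))))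
        - Gfactor k₁ k₂ a b q * Ffactor ((b : ℝ) / (2 * q)) *
          ((N : ℂ)⁻¹ * ∫ x in (0 : ℝ)..N, expc (t * α * x ^ 2))‖ ≤
      32 * k₂ * q * (1 + |(b : ℝ)|) / Q
        + 4 * Real.pi * (1 + 2 * α) * |t| * N * (2 * q * k₂ * Q) + 6 * (2 * q * k₂ * Q) / N := by
  have hα0 : 0 ≤ α := hα ▸ Real.sqrt_nonneg _
  have hn0 : (0 : ℝ) < n := by positivity
  have hN0 : 0 < N := by linarith
  have hn1 : (1 : ℝ) ≤ n := by exact_mod_cast hn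
  set B := 2 * q * k₂ * Q with hBdef
  have hB : 0 < B := by positivity
  have hB1 : (1 : ℝ) ≤ B := by exact_mod_cast hB
  have hBcast : (B : ℝ) = 2 * q * k₂ * Q := by rw [hBdef]; push_cast; ring
  have hvc : Continuous fun x : ℝ => expc (t * α * x ^ 2) := continuous_expc.comp (by fun_prop)
  have hz : ‖Gfactor k₁ k₂ a b q * Ffactor ((b : ℝ) / (2 * q))‖ ≤ 1 := by
    rw [norm_mul]
    exact mul_le_one₀ (norm_Gfactor_le_one _ _ _ _ _) (norm_nonneg _) (norm_Ffactor_le_one _)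
  set η := 2 * Real.pi * (|t| * N * B * (1 + 2 * α)) with hη
  have hη0 : 0 ≤ η := by positivity
  have hsq : ∀ (n₀ : ℕ) (x : ℝ), n₀ ≤ x → x ≤ n₀ + B → n₀ + B ≤ n →
      |x ^ 2 - (n₀ : ℝ) ^ 2| ≤ B * (2 * N) := by
    intro n₀ x h1 h2 h3
    have h3' : (n₀ : ℝ) + B ≤ n := by exact_mod_cast h3
    have h0 : (0 : ℝ) ≤ n₀ := Nat.cast_nonneg _
    rw [sq_sub_sq, mul_comm, abs_of_nonneg (mul_nonneg (by linarith) (by linarith))]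
    apply mul_le_mul <;> linarith
  have hsum := norm_sum_mul_sub_integral_le (B := B) (n := n) (η := η)
    (u := fun i => beattyPhase k₁ k₂ a b q ((i + 1 : ℕ) : ℤ) ((i + 1 : ℕ) * α))
    (w := fun i => expc (t * (((i + 1 : ℕ) : ℝ) * (⌊((i + 1 : ℕ) : ℝ) * α⌋ : ℝ))))
    (v := fun x => expc (t * α * x ^ 2))
    (E₀ := 16 * ((2 * q * k₂ : ℕ) : ℝ) ^ 2 * (1 + |(b : ℝ)|)) hB
    (fun i => (norm_beattyPhase _ _ _ _ _ _ _).le) (fun i => (norm_expc _).le)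
    (fun x => (norm_expc _).le) hvc hz (by positivity) hη0
    (fun n₀ => by
      have h := norm_sum_beattyPhase_block_le (k₁ := k₁) hk₂ a b hq hQ hp happ (n₀ + 1)
      have e : ∀ i, n₀ + i + 1 = n₀ + 1 + i := fun i => by ring
      simp only [e]
      exact h)
    (fun n₀ i hi hB' => by
      refine (norm_expc_sub_expc_le _ _).trans ?_
      rw [hη]
      have hi' : ((n₀ + i + 1 : ℕ) : ℝ) ≤ n₀ + B := by exact_mod_cast (by lia)
      have h1 := hsq n₀ ((n₀ + i + 1 : ℕ) : ℝ) (by exact_mod_cast (by lia)) hi' hB'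
      have hmN : ((n₀ + i + 1 : ℕ) : ℝ) ≤ N := by
        have : (n₀ : ℝ) + B ≤ n := by exact_mod_cast hB'
        linarith
      set m : ℝ := ((n₀ + i + 1 : ℕ) : ℝ)
      have hm0 : 0 ≤ m := Nat.cast_nonneg _
      have e : t * (m * (⌊m * α⌋ : ℝ)) - t * α * (n₀ : ℝ) ^ 2 =
          t * (-(m * Int.fract (m * α)) + α * (m ^ 2 - (n₀ : ℝ) ^ 2)) := by
        rw [Int.fract]; ring
      rw [e, abs_mul]
      have h2 : |-(m * Int.fract (m * α)) + α * (m ^ 2 - (n₀ : ℝ) ^ 2)| ≤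
          N * 1 + α * (B * (2 * N)) := by
        refine (abs_add_le _ _).trans ?_
        rw [abs_neg, abs_mul, abs_mul, abs_of_nonneg hm0, abs_of_nonneg hα0, Int.abs_fract]
        have := (Int.fract_lt_one (m * α)).le
        have := Int.fract_nonneg (m * α)
        gcongr
      have h3 : N * 1 + α * (B * (2 * N)) ≤ N * B * (1 + 2 * α) := by
        nlinarith
      calc _ ≤ 2 * Real.pi * (|t| * (N * B * (1 + 2 * α))) := by
            gcongr; exact h2.trans h3
        _ = _ := by ring)
    (fun n₀ x h1 h2 hB' => by
      refine (norm_expc_sub_expc_le _ _).trans ?_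
      rw [hη]
      have e : t * α * x ^ 2 - t * α * (n₀ : ℝ) ^ 2 = t * (α * (x ^ 2 - (n₀ : ℝ) ^ 2)) := by ring
      rw [e, abs_mul, abs_mul, abs_of_nonneg hα0]
      have h3 : α * (B * (2 * N)) ≤ N * B * (1 + 2 * α) := by
        have : 0 ≤ N * B := by positivity
        nlinarith
      calc _ ≤ 2 * Real.pi * (|t| * (N * B * (1 + 2 * α))) := by
            have h4 := mul_le_mul_of_nonneg_left (hsq n₀ x h1 h2 hB') hα0
            exact mul_le_mul_of_nonneg_left (mul_le_mul_of_nonneg_left (h4.trans h3)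
              (abs_nonneg t)) (by positivity)
        _ = _ := by ring)
  have hS : ∑ m ∈ Finset.Icc 1 n, expc ((((a : ℝ) + (b : ℝ) * α) / q + t) *
          ((m : ℝ) * (⌊(m : ℝ) * α⌋ : ℝ))) =
      ∑ i ∈ Finset.range n, beattyPhase k₁ k₂ a b q ((i + 1 : ℕ) : ℤ) ((i + 1 : ℕ) * α) *
        expc (t * (((i + 1 : ℕ) : ℝ) * (⌊((i + 1 : ℕ) : ℝ) * α⌋ : ℝ))) := by
    rw [sum_Icc_one_eq_sum_range]
    refine Finset.sum_congr rfl fun i _ => ?_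
    rw [hα, ← expc_eq_beattyPhase hk₂ a b hq, ← expc_add, add_mul]
  rw [hS]
  have h := norm_average_sub_average_le hn hnN hNn hvc (fun x => (norm_expc _).le) hz hsum
  refine h.trans ?_
  have hN2 : N ≤ 2 * n := by linarith
  have e1 : ((n : ℝ) / B * (16 * ((2 * q * k₂ : ℕ) : ℝ) ^ 2 * (1 + |(b : ℝ)|) + 2 * B * η) + 2 * B)
      / n + 2 / N = 32 * k₂ * q * (1 + |(b : ℝ)|) / Q + 2 * η + 2 * B / n + 2 / N := by
    rw [hBcast]
    push_cast
    field_simp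
    ring
  have e2 : 2 * (B : ℝ) / n ≤ 4 * B / N := by
    rw [div_le_div_iff₀ hn0 hN0]
    nlinarith
  have e3 : 2 / N ≤ 2 * B / N := by
    gcongr
    linarith
  have e4 : 4 * (B : ℝ) / N + 2 * B / N = 6 * B / N := by ring
  rw [e1, ← hBcast]
  have e5 : 2 * η = 4 * Real.pi * (1 + 2 * α) * |t| * N * B := by rw [hη]; ring
  linarith

/-- **Major arc approximation** (Proposition: Major arcs).
For every positive rational `k = k₁/k₂` in lowest terms with `√k` irrational and every
`κ ∈ (0,1)` there exists `C = C(k,κ) > 0` such that for every `N ≥ 1`, `q ∈ ℕ`, `a, b ∈ ℤ`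
and `t ∈ ℝ`,
`| 𝔼_{n∈[N]} e(((a+b√k)/q + t) n⌊n√k⌋) − G_k(a,b,q) F(b/(2q)) V_{N;k}(t) |
  ≤ C (N^{κ−1} + |t| N^{1+κ} + q²(1+|b|)(1+log N) N^{−κ/2})`. -/
theorem major_arc_approximation
    (k₁ k₂ : ℕ) (hk₁ : 0 < k₁) (hk₂ : 0 < k₂) (hcop : Nat.Coprime k₁ k₂)
    (hirr : Irrational (Real.sqrt ((k₁ : ℝ) / k₂)))
    (κ : ℝ) (hκ : κ ∈ Set.Ioo (0 : ℝ) 1) :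
    ∃ C > 0, ∀ (N : ℝ), 1 ≤ N → ∀ (q : ℕ), 0 < q → ∀ (a b : ℤ) (t : ℝ),
      ‖((⌊N⌋ : ℝ) : ℂ)⁻¹ * (∑ n ∈ Finset.Icc 1 (⌊N⌋).toNat,
            expc ((((a : ℝ) + (b : ℝ) * Real.sqrt ((k₁ : ℝ) / k₂)) / q + t) *
              ((n : ℝ) * (⌊(n : ℝ) * Real.sqrt ((k₁ : ℝ) / k₂)⌋ : ℝ))))
          - Gfactor k₁ k₂ a b q * Ffactor ((b : ℝ) / (2 * q)) *
              Vfactor ((k₁ : ℝ) / k₂) N t‖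
        ≤ C * (N ^ (κ - 1) + |t| * N ^ (1 + κ) +
            (q : ℝ) ^ 2 * (1 + |(b : ℝ)|) * (1 + Real.log N) * N ^ (-κ / 2)) := by
  obtain ⟨hκ0, hκ1⟩ := hκ
  obtain ⟨c, hc, happrox⟩ := exists_rat_approx_sqrt hk₂ hirr
  have hα0 : 0 ≤ Real.sqrt ((k₁ : ℝ) / k₂) := Real.sqrt_nonneg _
  set α := Real.sqrt ((k₁ : ℝ) / k₂) with hα
  refine ⟨32 * k₂ / c + 8 * Real.pi * k₂ * (1 + 2 * α) + 12 * k₂ + 2, by positivity, ?_⟩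
  intro N hN q hq a b t
  have hN0 : 0 < N := by linarith
  have hq1 : (1 : ℝ) ≤ q := by exact_mod_cast hq
  have hb1 : 1 ≤ 1 + |(b : ℝ)| := by linarith [abs_nonneg (b : ℝ)]
  have hlog : 1 ≤ 1 + Real.log N := by linarith [Real.log_nonneg hN]
  obtain ⟨n, hn⟩ : ∃ n : ℕ, ⌊N⌋ = n := Int.eq_ofNat_of_zero_le (Int.floor_nonneg.2 hN0.le)
  have hnN : (n : ℝ) ≤ N := by
    have := Int.floor_le N
    rw [hn] at this
    exact_mod_cast this
  have hNn : N ≤ n + 1 := by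
    have := (Int.lt_floor_add_one N).le
    rw [hn] at this
    exact_mod_cast this
  have hnpos : 0 < n := by
    have : (1 : ℤ) ≤ ⌊N⌋ := Int.le_floor.2 (by exact_mod_cast hN)
    lia
  rw [hn, Int.toNat_natCast, Int.cast_natCast, Complex.ofReal_natCast, Vfactor]
  set x := N ^ (κ / 2) with hx
  have hx1 : 1 ≤ x := Real.one_le_rpow hN (by linarith)
  have hx0 : 0 < x := by linarith
  have hxinv : N ^ (-κ / 2) = x⁻¹ := by rw [hx, ← Real.rpow_neg hN0.le]; ring_nf
  have hxx : x * x = N ^ κ := by rw [hx, ← Real.rpow_add hN0]; ring_nf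
  have hN1 : N ^ (1 + κ) = N * N ^ κ := by rw [Real.rpow_add hN0, Real.rpow_one]
  have hN2 : N ^ (κ - 1) = N ^ κ / N := by rw [Real.rpow_sub hN0, Real.rpow_one]
  rw [hxinv, hN1, hN2, ← hxx]
  have hB1 : 1 ≤ (1 + |(b : ℝ)|) * (1 + Real.log N) := one_le_mul_of_one_le_of_one_le hb1 hlog
  set T₁ := x * x / N with hT₁
  set T₂ := |t| * (N * (x * x)) with hT₂
  set T₃ := (q : ℝ) ^ 2 * (1 + |(b : ℝ)|) * (1 + Real.log N) * x⁻¹ with hT₃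
  have hT₁0 : 0 ≤ T₁ := by positivity
  have hT₂0 : 0 ≤ T₂ := by positivity
  have hT₃0 : 0 ≤ T₃ := by positivity
  have hA : 0 ≤ 32 * k₂ / c := by positivity
  have hA' : 0 ≤ 8 * Real.pi * k₂ * (1 + 2 * α) := by positivity
  have hA'' : (0 : ℝ) ≤ 12 * k₂ := by positivity
  rcases le_or_gt (q : ℝ) x with hqx | hqx
  · obtain ⟨p, Q, hQ, hp, happ, hcQ, hQx⟩ := happrox x hx1
    have h := norm_average_sub_le_of_rat_approx hk₂ a b hq hα hQ hp happ hnpos hnN hNn t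
    refine h.trans ?_
    have hB : (2 : ℝ) * q * k₂ * Q ≤ 2 * k₂ * (x * x) := by
      calc (2 : ℝ) * q * k₂ * Q ≤ 2 * x * k₂ * x := by gcongr
        _ = _ := by ring
    have h1 : 32 * k₂ * q * (1 + |(b : ℝ)|) / Q ≤ 32 * k₂ / c * T₃ := by
      have hqq : (q : ℝ) * (1 + |(b : ℝ)|) ≤ q ^ 2 * (1 + |(b : ℝ)|) * (1 + Real.log N) := by
        calc (q : ℝ) * (1 + |(b : ℝ)|) = q * (1 + |(b : ℝ)|) * 1 := by ring
          _ ≤ q ^ 2 * (1 + |(b : ℝ)|) * (1 + Real.log N) := by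
            gcongr
            exact le_self_pow₀ hq1 two_ne_zero
      calc 32 * k₂ * q * (1 + |(b : ℝ)|) / Q = 32 * k₂ * (q * (1 + |(b : ℝ)|)) / Q := by ring
        _ ≤ 32 * k₂ * (q ^ 2 * (1 + |(b : ℝ)|) * (1 + Real.log N)) / (c * x) := by gcongr
        _ = 32 * k₂ / c * T₃ := by rw [hT₃]; field_simp
    have h2 : 4 * Real.pi * (1 + 2 * α) * |t| * N * (2 * q * k₂ * Q) ≤
        8 * Real.pi * k₂ * (1 + 2 * α) * T₂ := by
      calc 4 * Real.pi * (1 + 2 * α) * |t| * N * (2 * q * k₂ * Q)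
          ≤ 4 * Real.pi * (1 + 2 * α) * |t| * N * (2 * k₂ * (x * x)) := by gcongr
        _ = _ := by rw [hT₂]; ring
    have h3 : 6 * (2 * q * k₂ * Q) / N ≤ 12 * k₂ * T₁ := by
      calc 6 * (2 * q * k₂ * Q) / N ≤ 6 * (2 * k₂ * (x * x)) / N := by gcongr
        _ = _ := by rw [hT₁]; ring
    generalize 32 * k₂ / c = A at *
    generalize 8 * Real.pi * k₂ * (1 + 2 * α) = A' at *
    generalize (12 : ℝ) * k₂ = A'' at *
    have := mul_nonneg hA hT₁0
    have := mul_nonneg hA hT₂0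
    have := mul_nonneg hA' hT₁0
    have := mul_nonneg hA' hT₃0
    have := mul_nonneg hA'' hT₂0
    have := mul_nonneg hA'' hT₃0
    linarith
  · have hS : ‖(n : ℂ)⁻¹ * (∑ m ∈ Finset.Icc 1 n, expc ((((a : ℝ) + (b : ℝ) * α) / q + t) *
          ((m : ℝ) * (⌊(m : ℝ) * α⌋ : ℝ))))‖ ≤ 1 := by
      rw [norm_mul, norm_inv, Complex.norm_natCast]
      refine inv_mul_le_one_of_le₀ ?_ (by positivity)
      refine (norm_sum_le_of_le _ fun m _ => (norm_expc _).le).trans (le_of_eq ?_)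
      simp
    have hV : ‖(N : ℂ)⁻¹ * ∫ x in (0 : ℝ)..N, expc (t * α * x ^ 2)‖ ≤ 1 := by
      rw [norm_mul, norm_inv, Complex.norm_real, Real.norm_of_nonneg hN0.le]
      refine inv_mul_le_one_of_le₀ ?_ hN0.le
      have := intervalIntegral.norm_integral_le_of_norm_le_const (a := (0 : ℝ)) (b := N) (C := 1)
        (f := fun x => expc (t * α * x ^ 2)) fun x _ => (norm_expc _).le
      rwa [one_mul, sub_zero, abs_of_pos hN0] at this
    have hz : ‖Gfactor k₁ k₂ a b q * Ffactor ((b : ℝ) / (2 * q)) *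
        ((N : ℂ)⁻¹ * ∫ x in (0 : ℝ)..N, expc (t * α * x ^ 2))‖ ≤ 1 := by
      rw [norm_mul, norm_mul]
      exact mul_le_one₀ (mul_le_one₀ (norm_Gfactor_le_one _ _ _ _ _) (norm_nonneg _)
        (norm_Ffactor_le_one _)) (norm_nonneg _) hV
    have hT : 1 ≤ T₃ := by
      rw [hT₃, ← div_eq_mul_inv, one_le_div hx0]
      calc x ≤ q := hqx.le
        _ ≤ (q : ℝ) ^ 2 * 1 := by rw [mul_one]; exact le_self_pow₀ hq1 two_ne_zero
        _ ≤ (q : ℝ) ^ 2 * ((1 + |(b : ℝ)|) * (1 + Real.log N)) := by gcongr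
        _ = _ := by ring
    calc _ ≤ (1 + 1 : ℝ) := norm_sub_le_of_le hS hz
      _ ≤ 2 * (T₁ + T₂ + T₃) := by linarith
      _ ≤ _ := by gcongr; linarith
end

section
/- Let k be a positive rational number such that √k is irrational. Then there exists a positive constant C = C(k) such that for every nonempty finite interval I ⊆ ℤ, all natural numbers D, q, and all r, s ∈ ℕ and d ∈ {0, ..., D−1}, one has | (1/|I|) · #{ n ∈ I : n ≡ r (mod q), ⌊n√k⌋ ≡ s (mod q), {n√k} ∈ [d/D, (d+1)/D) } − 1/(q² D) | ≤ C (1 + log|I|)/|I|. -/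
open MeasureTheory

/-- `x` lies in the arc `[a, b)` of the circle `ℝ / ℤ`. -/
def InArc (a b x : ℝ) : Prop := ∃ w : ℤ, a + w ≤ x ∧ x < b + w

open Classical in
/-- The number of `m ∈ {m₀, …, m₀ + M - 1}` such that `m α` lies in the arc `[a, b)` modulo `1`. -/
noncomputable def arcCount (α a b : ℝ) (m₀ : ℤ) (M : ℕ) : ℕ :=
  ((Finset.Ico m₀ (m₀ + M)).filter fun m : ℤ => InArc a b (m * α)).card

/-- Every point of the circle lies in an arc or in its complement. -/
theorem inArc_or_inArc_compl (a b x : ℝ) :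
    InArc a b x ∨ InArc b (a + 1) x := by
  have h1 := Int.floor_le (x - a)
  have h2 := Int.lt_floor_add_one (x - a)
  by_cases h : x < b + ⌊x - a⌋
  · exact Or.inl ⟨⌊x - a⌋, by linarith, h⟩
  · exact Or.inr ⟨⌊x - a⌋, by linarith, by linarith⟩

theorem le_arcCount_add_arcCount_compl (α a b : ℝ) (m₀ : ℤ) (M : ℕ) :
    M ≤ arcCount α a b m₀ M + arcCount α b (a + 1) m₀ M := by
  classical
  unfold arcCount
  calc M = (Finset.Ico m₀ (m₀ + M)).card := by simp
    _ ≤ _ := Finset.card_le_card fun m hm => ?_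
    _ ≤ _ := Finset.card_union_le _ _
  rw [← Finset.filter_or]
  exact Finset.mem_filter.2 ⟨hm, inArc_or_inArc_compl a b _⟩

theorem arcCount_add_le (α a b : ℝ) (m₀ : ℤ) (M N : ℕ) :
    arcCount α a b m₀ (M + N) ≤ arcCount α a b m₀ M + arcCount α a b (m₀ + M) N := by
  classical
  unfold arcCount
  refine (Finset.card_le_card fun m hm => ?_).trans (Finset.card_union_le _ _)
  simp only [Finset.mem_union, Finset.mem_filter, Finset.mem_Ico] at hm ⊢
  obtain ⟨hm, hw⟩ := hm
  push_cast at hm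
  by_cases h : m < m₀ + M
  · exact Or.inl ⟨⟨hm.1, h⟩, hw⟩
  · exact Or.inr ⟨⟨by omega, by omega⟩, hw⟩

/-- A block of consecutive multiples of `α`, as long as the denominator of a good rational
approximation, has bounded excess in every arc. -/
theorem arcCount_den_le {α : ℝ} {x : ℚ} (hx : |α - x| ≤ 1 / (x.den : ℝ) ^ 2)
    {a b : ℝ} (hab : a ≤ b) (m₀ : ℤ) :
    (arcCount α a b m₀ x.den : ℝ) ≤ x.den * (b - a) + 3 := by
  classical
  have hQ : (0 : ℝ) < x.den := by exact_mod_cast x.pos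
  set Q := x.den with hQdef
  have hnum : (x : ℝ) * Q = x.num := by exact_mod_cast Rat.mul_den_eq_num x
  set u : ℝ := Q * (a - m₀ * α) - 1
  set v : ℝ := Q * (b - m₀ * α) + 1
  have huv : u ≤ v := by
    have := mul_le_mul_of_nonneg_left hab hQ.le
    simp only [u, v]; linarith
  have hcard : arcCount α a b m₀ Q ≤ (Finset.Icc ⌈u⌉ ⌊v⌋).card := by
    have hex : ∀ m : ℤ, ∃ w : ℤ, InArc a b (m * α) → a + w ≤ m * α ∧ m * α < b + w := fun m => by
      by_cases h : InArc a b (m * α)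
      · exact h.imp fun w hw _ => hw
      · exact ⟨0, fun h' => absurd h' h⟩
    choose w hw using hex
    refine Finset.card_le_card_of_injOn (fun m => (m - m₀) * x.num - Q * w m) ?_ ?_
    · intro m hm
      simp only [Finset.coe_filter, Finset.mem_Ico, Set.mem_ofPred_eq] at hm
      obtain ⟨⟨hm1, hm2⟩, hm3⟩ := hm
      obtain ⟨hw1, hw2⟩ := hw m hm3
      have hj0 : (0 : ℝ) ≤ m - m₀ := by
        have : (m₀ : ℝ) ≤ m := by exact_mod_cast hm1
        linarith
      have hjQ : (m : ℝ) - m₀ ≤ Q := by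
        have : (m : ℝ) < m₀ + Q := by exact_mod_cast hm2
        linarith
      have herr : |(Q * (m - m₀) * (α - x) : ℝ)| ≤ 1 := by
        rw [abs_mul, abs_mul, abs_of_pos hQ, abs_of_nonneg hj0]
        calc (Q * (m - m₀) * |α - x| : ℝ) ≤ Q * Q * (1 / (Q : ℝ) ^ 2) := by gcongr
          _ = 1 := by field_simp
      obtain ⟨he1, he2⟩ := abs_le.1 herr
      have h1 := mul_le_mul_of_nonneg_left hw1 hQ.le
      have h2 := mul_le_mul_of_nonneg_left hw2.le hQ.le
      simp only [Finset.coe_Icc, Set.mem_Icc, Int.ceil_le, Int.le_floor]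
      push_cast
      rw [← hnum]
      simp only [u, v]
      constructor <;> nlinarith
    · intro m hm m' hm' h
      simp only [Finset.coe_filter, Finset.mem_Ico, Set.mem_ofPred_eq] at hm hm' h
      have hdvd : (Q : ℤ) ∣ (m - m') * x.num := ⟨w m - w m', by linear_combination h⟩
      have hcop : IsCoprime (Q : ℤ) x.num := by
        rw [Int.isCoprime_iff_nat_coprime]
        simpa using x.reduced.symm
      have hd := hcop.dvd_of_dvd_mul_right hdvd
      have := Int.eq_zero_of_abs_lt_dvd hd (by rw [abs_lt]; constructor <;> omega)
      omega
  have hle : ((Finset.Icc ⌈u⌉ ⌊v⌋).card : ℝ) ≤ v - u + 1 := by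
    rw [Int.card_Icc]
    have h1 := Int.floor_le v
    have h2 := Int.le_ceil u
    rcases le_total 0 (⌊v⌋ + 1 - ⌈u⌉) with h | h
    · have : (((⌊v⌋ + 1 - ⌈u⌉).toNat : ℤ) : ℝ) = ((⌊v⌋ + 1 - ⌈u⌉ : ℤ) : ℝ) := by
        rw [Int.toNat_of_nonneg h]
      push_cast at this
      rw [this]; linarith
    · rw [Int.toNat_of_nonpos h]; push_cast; linarith
  calc (arcCount α a b m₀ Q : ℝ) ≤ (Finset.Icc ⌈u⌉ ⌊v⌋).card := by exact_mod_cast hcard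
    _ ≤ v - u + 1 := hle
    _ = Q * (b - a) + 3 := by simp only [u, v]; ring

/-- Logarithmic upper bound for the discrepancy of a badly approximable number. -/
theorem arcCount_le_of_badly_approximable {α c : ℝ} (hc : 0 < c)
    (hα : ∀ x : ℚ, c / (x.den : ℝ) ^ 2 ≤ |α - x|) {a b : ℝ} (hab : a ≤ b) (M : ℕ) (hM : 0 < M)
    (m₀ : ℤ) : (arcCount α a b m₀ M : ℝ) ≤ M * (b - a) + (3 + 3 / c) * (1 + Real.log M) := by
  induction M using Nat.strong_induction_on generalizing m₀ with
  | _ M ih =>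
  obtain ⟨x, hx, hxM⟩ := Real.exists_rat_abs_sub_le_and_den_le α hM
  have hQ : (0 : ℝ) < x.den := by exact_mod_cast x.pos
  have hMr : (0 : ℝ) < M := by exact_mod_cast hM
  have hxM' : (x.den : ℝ) ≤ M := by exact_mod_cast hxM
  have hblock := arcCount_den_le (α := α) (x := x)
    (hx.trans (by rw [sq]; gcongr; linarith)) hab m₀
  have hden : c * M ≤ x.den := by
    have h := (hα x).trans hx
    rw [div_le_div_iff₀ (by positivity) (by positivity)] at h
    have : c * (M + 1) ≤ x.den := by
      refine le_of_mul_le_mul_right ?_ hQ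
      linarith
    linarith
  obtain ⟨N, rfl⟩ := Nat.exists_eq_add_of_le hxM
  have hsplit : (arcCount α a b m₀ (x.den + N) : ℝ) ≤
      arcCount α a b m₀ x.den + arcCount α a b (m₀ + x.den) N := by
    exact_mod_cast arcCount_add_le α a b m₀ x.den N
  have hlog : 0 ≤ Real.log ((x.den + N : ℕ) : ℝ) := Real.log_natCast_nonneg _
  have hc3 : 0 < 3 / c := by positivity
  rcases Nat.eq_zero_or_pos N with rfl | hN
  · simp only [arcCount, Nat.cast_zero, add_zero, Finset.Ico_self, Finset.filter_empty,
      Finset.card_empty] at hsplit hblock hlog ⊢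
    nlinarith
  · have hNr : (0 : ℝ) < N := by exact_mod_cast hN
    have hrest := ih N (by have := x.pos; omega) hN (m₀ + x.den)
    have hratio : Real.log N ≤ Real.log ((x.den + N : ℕ) : ℝ) - c := by
      have h := Real.log_le_sub_one_of_pos (div_pos hNr hMr)
      rw [Real.log_div hNr.ne' hMr.ne'] at h
      have : (N : ℝ) / ((x.den + N : ℕ) : ℝ) ≤ 1 - c := by
        rw [div_le_iff₀ hMr]
        push_cast at hden ⊢
        linarith
      linarith
    have hmul := mul_le_mul_of_nonneg_left hratio (by positivity : 0 ≤ 3 + 3 / c)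
    have hcc : 3 / c * c = 3 := by field_simp
    push_cast at hmul hlog ⊢
    nlinarith

/-- Logarithmic bound for the discrepancy of a badly approximable number. -/
theorem abs_arcCount_sub_le_of_badly_approximable {α c : ℝ} (hc : 0 < c)
    (hα : ∀ x : ℚ, c / (x.den : ℝ) ^ 2 ≤ |α - x|) {a b : ℝ} (hab : a ≤ b) (hb : b ≤ a + 1)
    {M : ℕ} (hM : 0 < M) (m₀ : ℤ) :
    |(arcCount α a b m₀ M : ℝ) - M * (b - a)| ≤ (3 + 3 / c) * (1 + Real.log M) := by
  have h1 := arcCount_le_of_badly_approximable hc hα hab M hM m₀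
  have h2 := arcCount_le_of_badly_approximable hc hα hb M hM m₀
  have h3 : (M : ℝ) ≤ arcCount α a b m₀ M + arcCount α b (a + 1) m₀ M := by
    exact_mod_cast le_arcCount_add_arcCount_compl α a b m₀ M
  rw [abs_le]
  constructor <;> linarith

/-- Irrational square roots of rationals are badly approximable. -/
theorem exists_badly_approximable_sqrt {k : ℚ} (hk : 0 < k)
    (hirr : Irrational (Real.sqrt (k : ℝ))) :
    ∃ c > 0, ∀ x : ℚ, c / (x.den : ℝ) ^ 2 ≤ |Real.sqrt (k : ℝ) - x| := by
  have hkr : (0 : ℝ) ≤ k := by exact_mod_cast hk.le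
  set α := Real.sqrt (k : ℝ)
  have hα0 : 0 ≤ α := Real.sqrt_nonneg _
  have hαsq : α ^ 2 = k := Real.sq_sqrt hkr
  have hv : (1 : ℝ) ≤ k.den := by exact_mod_cast k.pos
  refine ⟨1 / (k.den * (2 * α + 1)), by positivity, fun x => ?_⟩
  have hQ : (1 : ℝ) ≤ x.den := by exact_mod_cast x.pos
  rw [div_div, div_le_iff₀ (by positivity)]
  rcases le_total 1 |α - x| with h | h
  · have h1 : (1 : ℝ) ≤ k.den * (2 * α + 1) * (x.den : ℝ) ^ 2 :=
      one_le_mul_of_one_le_of_one_le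
        (one_le_mul_of_one_le_of_one_le hv (by linarith)) (one_le_pow₀ hQ)
    exact one_le_mul_of_one_le_of_one_le h h1
  · have hnum : (x : ℝ) * x.den = x.num := by exact_mod_cast Rat.mul_den_eq_num x
    have hknum : (k : ℝ) * k.den = k.num := by exact_mod_cast Rat.mul_den_eq_num k
    have hne : (k.num * (x.den : ℤ) ^ 2 - k.den * x.num ^ 2 : ℤ) ≠ 0 := by
      intro h0
      have h0' : (k.num * (x.den : ℝ) ^ 2 - k.den * (x.num : ℝ) ^ 2 : ℝ) = 0 := by
        exact_mod_cast h0
      rw [← hnum, ← hknum] at h0'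
      have h2 : ((k.den : ℝ) * (x.den : ℝ) ^ 2) * (α ^ 2 - (x : ℝ) ^ 2) = 0 := by
        rw [hαsq]; linarith
      have h3 : α ^ 2 = (x : ℝ) ^ 2 := by
        rcases mul_eq_zero.1 h2 with h | h
        · exact absurd h (by positivity)
        · linarith
      rcases sq_eq_sq_iff_eq_or_eq_neg.1 h3 with h | h
      · exact hirr ⟨x, h.symm⟩
      · exact hirr ⟨-x, by push_cast; exact h.symm⟩
    have hone : (1 : ℝ) ≤ |(k.num * (x.den : ℝ) ^ 2 - k.den * (x.num : ℝ) ^ 2 : ℝ)| := by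
      exact_mod_cast Int.one_le_abs hne
    rw [← hnum, ← hknum, ← hαsq] at hone
    have hfac : α ^ 2 * k.den * (x.den : ℝ) ^ 2 - k.den * ((x : ℝ) * x.den) ^ 2 =
        (α - x) * (k.den * (α + x) * (x.den : ℝ) ^ 2) := by ring
    rw [hfac, abs_mul, abs_mul, abs_mul, abs_of_nonneg (by positivity : (0 : ℝ) ≤ k.den),
      abs_of_nonneg (by positivity : (0 : ℝ) ≤ (x.den : ℝ) ^ 2)] at hone
    have hsum : |α + x| ≤ 2 * α + 1 := by
      rw [abs_le] at h ⊢
      constructor <;> linarith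
    exact hone.trans (by gcongr)

/-- The congruence and fractional part conditions on `y` say that `y / q` lies in a fixed arc. -/
theorem floor_modEq_and_fract_mem_iff {D q d : ℕ} (hD : 0 < D) (hd : d < D) (s : ℤ) (y : ℝ) :
    (⌊y⌋ ≡ s [ZMOD (q : ℤ)] ∧ Int.fract y ∈ Set.Ico ((d : ℝ) / D) (((d : ℝ) + 1) / D)) ↔
      ∃ w : ℤ, s + (d : ℝ) / D + q * w ≤ y ∧ y < s + ((d : ℝ) + 1) / D + q * w := by
  have hDr : (0 : ℝ) < D := by exact_mod_cast hD
  have h0 : 0 ≤ (d : ℝ) / D := by positivity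
  have h1 : ((d : ℝ) + 1) / D ≤ 1 := by
    rw [div_le_one hDr]; exact_mod_cast hd
  constructor
  · rintro ⟨hs, hf1, hf2⟩
    obtain ⟨w, hw⟩ := hs.symm.dvd
    have hw' : (⌊y⌋ : ℝ) - s = q * w := by exact_mod_cast hw
    have := Int.floor_add_fract y
    exact ⟨w, by linarith, by linarith⟩
  · rintro ⟨w, hw1, hw2⟩
    have hfl : ⌊y⌋ = s + q * w := by
      rw [Int.floor_eq_iff]
      push_cast
      constructor <;> linarith
    refine ⟨?_, ?_⟩
    · rw [hfl]
      exact (Int.modEq_iff_dvd.2 ⟨w, by ring⟩ : s ≡ s + q * w [ZMOD (q : ℤ)]).symm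
    · rw [Int.fract, hfl, Set.mem_Ico]
      push_cast
      constructor <;> linarith

/-- The elements of `[lo, hi]` in a residue class modulo `q` are `r + q m`, for `m` in an interval
of about `(hi + 1 - lo) / q` integers. -/
theorem exists_interval_mul_add_mem_Icc {lo hi : ℤ} (hle : lo ≤ hi) {q : ℕ} (hq : 0 < q) (r : ℤ) :
    ∃ (m₀ : ℤ) (M : ℕ), (M : ℤ) ≤ hi + 1 - lo ∧ |(M : ℝ) - (hi + 1 - lo) / q| ≤ 1 ∧
      ∀ m : ℤ, r + q * m ∈ Finset.Icc lo hi ↔ m ∈ Finset.Ico m₀ (m₀ + M) := by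
  have hqz : (0 : ℤ) < q := by exact_mod_cast hq
  have hqr : (0 : ℝ) < q := by exact_mod_cast hq
  set u : ℝ := ((lo - r : ℤ) : ℝ) / q with hu
  set v : ℝ := ((hi + 1 - r : ℤ) : ℝ) / q with hv
  have huv : u ≤ v := by
    rw [hu, hv]; gcongr; omega
  have hceil : ⌈u⌉ ≤ ⌈v⌉ := Int.ceil_le_ceil huv
  obtain ⟨M, hM⟩ := Int.eq_ofNat_of_zero_le (sub_nonneg.2 hceil)
  have hMr : (M : ℝ) = ⌈v⌉ - ⌈u⌉ := by exact_mod_cast hM.symm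
  have hvu : v - u = (hi + 1 - lo) / q := by
    rw [hu, hv]; push_cast; ring
  have hu1 := Int.le_ceil u
  have hu2 := Int.ceil_lt_add_one u
  have hv1 := Int.le_ceil v
  have hv2 := Int.ceil_lt_add_one v
  refine ⟨⌈u⌉, M, ?_, ?_, fun m => ?_⟩
  · have hq1 : (1 : ℝ) ≤ q := by exact_mod_cast hq
    have hN : (0 : ℝ) ≤ hi + 1 - lo := by
      have : (lo : ℝ) ≤ hi := by exact_mod_cast hle
      linarith
    have h : (hi + 1 - lo : ℝ) / q ≤ hi + 1 - lo := div_le_self hN hq1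
    have h2 : (M : ℝ) < (hi + 1 - lo) + 1 := by linarith
    have h3 : (M : ℤ) < (hi + 1 - lo) + 1 := by exact_mod_cast h2
    omega
  · rw [← hvu, abs_le]
    constructor <;> linarith
  · have hadd : ⌈u⌉ + (M : ℤ) = ⌈v⌉ := by
      have : ⌈v⌉ - ⌈u⌉ = (M : ℤ) := hM
      omega
    rw [hadd, Finset.mem_Icc, Finset.mem_Ico, Int.ceil_le, Int.lt_ceil, hu, hv,
      div_le_iff₀ hqr, lt_div_iff₀ hqr]
    norm_cast
    rw [mul_comm m]
    constructor <;> rintro ⟨h1, h2⟩ <;> constructor <;> omega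

/-- The solutions `n` of the congruence and fractional part conditions are counted by an
`arcCount`. -/
theorem ncard_eq_arcCount {α : ℝ} {lo hi m₀ : ℤ} {D q d M : ℕ} (hD : 0 < D) (hq : 0 < q)
    (hd : d < D) (r s : ℕ)
    (hm : ∀ m : ℤ, (r : ℤ) + q * m ∈ Finset.Icc lo hi ↔ m ∈ Finset.Ico m₀ (m₀ + M)) :
    Set.ncard {n : ℤ | n ∈ Finset.Icc lo hi ∧ n ≡ (r : ℤ) [ZMOD (q : ℤ)] ∧
        ⌊(n : ℝ) * α⌋ ≡ (s : ℤ) [ZMOD (q : ℤ)] ∧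
        Int.fract ((n : ℝ) * α) ∈ Set.Ico ((d : ℝ) / D) (((d : ℝ) + 1) / D)} =
      arcCount α ((s + (d : ℝ) / D - r * α) / q) ((s + ((d : ℝ) + 1) / D - r * α) / q) m₀ M := by
  classical
  have hqr : (0 : ℝ) < q := by exact_mod_cast hq
  have hinj : Function.Injective fun m : ℤ => (r : ℤ) + q * m := fun m m' h => by
    simpa [hq.ne'] using h
  have hiff : ∀ m : ℤ,
      InArc ((s + (d : ℝ) / D - r * α) / q) ((s + ((d : ℝ) + 1) / D - r * α) / q) (m * α) ↔
      (⌊(((r : ℤ) + q * m : ℤ) : ℝ) * α⌋ ≡ (s : ℤ) [ZMOD (q : ℤ)] ∧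
        Int.fract ((((r : ℤ) + q * m : ℤ) : ℝ) * α) ∈
          Set.Ico ((d : ℝ) / D) (((d : ℝ) + 1) / D)) := fun m => by
    rw [floor_modEq_and_fract_mem_iff hD hd, InArc]
    refine exists_congr fun w => ?_
    rw [← le_sub_iff_add_le, ← sub_lt_iff_lt_add, div_le_iff₀ hqr, lt_div_iff₀ hqr]
    push_cast
    constructor <;> rintro ⟨h1, h2⟩ <;> constructor <;> linarith
  rw [arcCount, ← Finset.card_image_of_injective _ hinj, ← Set.ncard_coe_finset]
  congr 1
  ext n
  simp only [Set.mem_ofPred_eq, Finset.coe_image, Finset.coe_filter, Set.mem_image]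
  constructor
  · rintro ⟨hn, hr, hrest⟩
    obtain ⟨m, h⟩ := hr.symm.dvd
    obtain rfl : n = (r : ℤ) + q * m := by linarith
    exact ⟨m, ⟨(hm m).1 hn, (hiff m).2 hrest⟩, rfl⟩
  · rintro ⟨m, ⟨hm', harc⟩, rfl⟩
    have hmod : (r : ℤ) ≡ r + q * m [ZMOD (q : ℤ)] := Int.modEq_iff_dvd.2 ⟨m, by ring⟩
    exact ⟨(hm m).2 hm', hmod.symm, (hiff m).1 harc⟩

/-- **Effective equidistribution of `(n, ⌊n√k⌋, {n√k})` in `(ℤ/qℤ) × (ℤ/qℤ) × 𝕋`.**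
Let `k` be a positive rational with `√k` irrational.  Then there is `C = C(k) > 0` such that
for every nonempty finite interval `I = {lo, …, hi} ⊆ ℤ`, all `D, q ∈ ℕ` (positive), all
`r, s ∈ ℕ` and all `d ∈ {0, …, D−1}`,
`| (1/|I|) #{n ∈ I : n ≡ r (mod q), ⌊n√k⌋ ≡ s (mod q), {n√k} ∈ [d/D, (d+1)/D)} − 1/(q²D) |
  ≤ C (1 + log|I|)/|I|`. -/
theorem effective_equidistribution
    (k : ℚ) (hk : 0 < k) (hirr : Irrational (Real.sqrt (k : ℝ))) :
    ∃ C > 0, ∀ (lo hi : ℤ), lo ≤ hi → ∀ (D q r s : ℕ), 0 < D → 0 < q →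
      ∀ d : ℕ, d < D →
      |(Set.ncard {n : ℤ | n ∈ Finset.Icc lo hi ∧
            n ≡ (r : ℤ) [ZMOD (q : ℤ)] ∧
            ⌊(n : ℝ) * Real.sqrt (k : ℝ)⌋ ≡ (s : ℤ) [ZMOD (q : ℤ)] ∧
            Int.fract ((n : ℝ) * Real.sqrt (k : ℝ)) ∈
              Set.Ico ((d : ℝ) / D) (((d : ℝ) + 1) / D)} : ℝ) /
          ((Finset.Icc lo hi).card : ℝ) - 1 / ((q : ℝ) ^ 2 * D)|
        ≤ C * (1 + Real.log ((Finset.Icc lo hi).card : ℝ)) /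
            ((Finset.Icc lo hi).card : ℝ) := by
  obtain ⟨c, hc, hα⟩ := exists_badly_approximable_sqrt hk hirr
  refine ⟨(3 + 3 / c) + 1, by positivity, fun lo hi hle D q r s hD hq d hd => ?_⟩
  obtain ⟨m₀, M, hMN, hMq, hm⟩ := exists_interval_mul_add_mem_Icc hle hq r
  rw [ncard_eq_arcCount hD hq hd r s hm]
  have hcard : ((Finset.Icc lo hi).card : ℤ) = hi + 1 - lo := by
    rw [Int.card_Icc]; omega
  have hcard' : ((Finset.Icc lo hi).card : ℝ) = hi + 1 - lo := by exact_mod_cast hcard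
  rw [← hcard'] at hMq
  rw [← hcard] at hMN
  have hNpos : 0 < (Finset.Icc lo hi).card := by omega
  generalize (Finset.Icc lo hi).card = N at hMq hMN hNpos ⊢
  have hN : (0 : ℝ) < N := by exact_mod_cast hNpos
  have hDr : (1 : ℝ) ≤ D := by exact_mod_cast hD
  have hqr : (1 : ℝ) ≤ q := by exact_mod_cast hq
  have hqD : (1 : ℝ) ≤ q * D := one_le_mul_of_one_le_of_one_le hqr hDr
  set a : ℝ := (s + (d : ℝ) / D - r * √(k : ℝ)) / q
  set b : ℝ := (s + ((d : ℝ) + 1) / D - r * √(k : ℝ)) / q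
  have hlen : b - a = 1 / (q * D) := by simp only [a, b]; field_simp; ring
  have hlen0 : 0 ≤ b - a := by rw [hlen]; positivity
  have hlen1 : b - a ≤ 1 := by rw [hlen]; exact div_le_one_of_le₀ hqD (by positivity)
  have hlogN : 0 ≤ Real.log N := Real.log_natCast_nonneg N
  have hK : 0 < 3 + 3 / c := by positivity
  have hdisc : |(arcCount √(k : ℝ) a b m₀ M : ℝ) - M * (b - a)| ≤
      (3 + 3 / c) * (1 + Real.log N) := by
    rcases Nat.eq_zero_or_pos M with rfl | hM
    · simp only [arcCount, Nat.cast_zero, add_zero, Finset.Ico_self, Finset.filter_empty,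
        Finset.card_empty, zero_mul, sub_zero, abs_zero]
      positivity
    · refine (abs_arcCount_sub_le_of_badly_approximable hc hα (by linarith) (by linarith)
        hM m₀).trans ?_
      have hMr : (0 : ℝ) < M := by exact_mod_cast hM
      gcongr
      exact_mod_cast hMN
  have hmain : |(M : ℝ) * (b - a) - N / q * (b - a)| ≤ 1 := by
    rw [← sub_mul, abs_mul, abs_of_nonneg hlen0]
    exact mul_le_one₀ hMq hlen0 hlen1
  have hsplit : (arcCount √(k : ℝ) a b m₀ M : ℝ) / N - 1 / ((q : ℝ) ^ 2 * D) =
      ((arcCount √(k : ℝ) a b m₀ M - M * (b - a)) + (M * (b - a) - N / q * (b - a))) / N := by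
    rw [hlen]; field_simp; ring
  rw [hsplit, abs_div, abs_of_pos hN]
  gcongr
  exact (abs_add_le _ _).trans (by linarith)
end

section
/- Let α be an irrational real number, let q, q' ∈ ℕ, b, b' ∈ ℤ, a ∈ {1, ..., q} and a' ∈ {1, ..., q'} with gcd(a, b, q) = gcd(a', b', q') = 1. Then (a + bα)/q ≡ (a' + b'α)/q' (mod 1) if and only if (a, b, q) = (a', b', q'). -/
/-- If `x + y * α = 0` with `α` irrational and `x`, `y` integers, then `x = y = 0`. -/
theorem Irrational.eq_zero_of_intCast_add_intCast_mul_eq_zero {α : ℝ} (hα : Irrational α)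
    {x y : ℤ} (h : (x : ℝ) + (y : ℝ) * α = 0) : x = 0 ∧ y = 0 := by
  have hy : y = 0 := by
    by_contra hy
    exact ((hα.intCast_mul hy).intCast_add x).ne_zero h
  subst hy
  exact ⟨by simpa using h, rfl⟩

/-- If `gcd(a, b, q) = 1` and `q` divides both `a * c` and `b * c`, then `q` divides `c`. -/
theorem Int.dvd_of_dvd_mul_of_gcd_gcd_eq_one {a b q c : ℤ}
    (h : Int.gcd a (Int.gcd b q) = 1) (ha : q ∣ a * c) (hb : q ∣ b * c) : q ∣ c := by
  have hbez := Int.gcd_eq_gcd_ab a (Int.gcd b q)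
  rw [h, Int.gcd_eq_gcd_ab b q] at hbez
  generalize Int.gcdA a _ = x at hbez
  generalize Int.gcdB a _ = y at hbez
  obtain ⟨k, hk⟩ := ha
  obtain ⟨l, hl⟩ := hb
  refine ⟨k * x + (l * Int.gcdA b q + Int.gcdB b q * c) * y, ?_⟩
  push_cast at hbez
  linear_combination c * hbez + x * hk + Int.gcdA b q * y * hl


/-- **Unique representation for the major arc centers** (Lemma: Faithful).
Let `α` be irrational, `q, q' ∈ ℕ` positive, `b, b' ∈ ℤ`, `a ∈ {1, …, q}`, `a' ∈ {1, …, q'}`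
with `gcd(a, b, q) = gcd(a', b', q') = 1`.  Then
`(a + bα)/q ≡ (a' + b'α)/q' (mod 1)` if and only if `(a, b, q) = (a', b', q')`. -/
theorem unique_representation_major_arc_centers
    (α : ℝ) (hα : Irrational α)
    (q q' : ℕ) (hq : 0 < q) (hq' : 0 < q')
    (b b' a a' : ℤ)
    (ha₁ : 1 ≤ a) (ha₂ : a ≤ (q : ℤ)) (ha₁' : 1 ≤ a') (ha₂' : a' ≤ (q' : ℤ))
    (hgcd : Int.gcd a (Int.gcd b (q : ℤ)) = 1)
    (hgcd' : Int.gcd a' (Int.gcd b' (q' : ℤ)) = 1) :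
    (∃ m : ℤ, ((a : ℝ) + (b : ℝ) * α) / q - ((a' : ℝ) + (b' : ℝ) * α) / q' = (m : ℝ))
      ↔ (a = a' ∧ b = b' ∧ q = q') := by
  constructor
  · rintro ⟨m, hm⟩
    have hqR : (q : ℝ) ≠ 0 := by positivity
    have hqR' : (q' : ℝ) ≠ 0 := by positivity
    have hlin : ((a * q' - a' * q - m * q * q' : ℤ) : ℝ) + ((b * q' - b' * q : ℤ) : ℝ) * α = 0 := by
      field_simp at hm
      push_cast
      linear_combination hm
    obtain ⟨hx, hy⟩ := hα.eq_zero_of_intCast_add_intCast_mul_eq_zero hlin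
    have hdvd : (q : ℤ) ∣ q' := Int.dvd_of_dvd_mul_of_gcd_gcd_eq_one hgcd
      ⟨a' + m * q', by linear_combination hx⟩ ⟨b', by linear_combination hy⟩
    have hdvd' : (q' : ℤ) ∣ q := Int.dvd_of_dvd_mul_of_gcd_gcd_eq_one hgcd'
      ⟨a - m * q, by linear_combination -hx⟩ ⟨b, by linear_combination -hy⟩
    obtain rfl : q = q' := Nat.dvd_antisymm (Int.natCast_dvd_natCast.mp hdvd)
      (Int.natCast_dvd_natCast.mp hdvd')
    have hqZ : (q : ℤ) ≠ 0 := by positivity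
    have hb : b = b' := mul_right_cancel₀ hqZ (by linear_combination hy)
    have ha : a - a' = q * m := mul_right_cancel₀ hqZ (by linear_combination hx)
    have ha₀ : a - a' = 0 := Int.eq_zero_of_abs_lt_dvd ⟨m, ha⟩ (by rw [abs_lt]; lia)
    exact ⟨sub_eq_zero.mp ha₀, hb, rfl⟩
  · rintro ⟨rfl, rfl, rfl⟩
    exact ⟨0, by simp⟩
end

section
/- Let α be a real algebraic number of degree d ≥ 2 and let X, Y ≥ 1. Then there exists a positive constant c = c(α) such that for all triples (a, b, q) ≠ (a', b', q') with q, q' ∈ {1, ..., ⌊X⌋}, b, b' ∈ ℤ with |b|, |b'| ≤ Y, a ∈ {1, ..., q}, a' ∈ {1, ..., q'} and gcd(a, b, q) = gcd(a', b', q') = 1, one has ‖ (a + bα)/q − (a' + b'α)/q' ‖ > c X^{−d−1} Y^{−d+1}. -/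
/-- `‖x‖ = min_{n ∈ ℤ} |x − n|`, the distance from `x` to the nearest integer. -/
noncomputable def distToInt (x : ℝ) : ℝ := |x - (round x : ℤ)|

/-- An algebraic real of degree `d` over `ℚ` is a root of a nonzero integer polynomial of degree
at most `d`. -/
theorem exists_int_polynomial_root_of_isAlgebraic {α : ℝ} (halg : IsAlgebraic ℚ α) :
    ∃ f : Polynomial ℤ, f ≠ 0 ∧ f.natDegree ≤ (minpoly ℚ α).natDegree ∧
      Polynomial.eval α (f.map (algebraMap ℤ ℝ)) = 0 := by
  have hp : minpoly ℚ α ≠ 0 := minpoly.ne_zero halg.isIntegral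
  refine ⟨IsLocalization.integerNormalization (nonZeroDivisors ℤ) (minpoly ℚ α), ?_, ?_, ?_⟩
  · rwa [Ne, IsFractionRing.integerNormalization_eq_zero_iff]
  · exact Polynomial.natDegree_le_natDegree
      (Finset.sup_mono (IsLocalization.integerNormalization_support _ _))
  · rw [← Polynomial.eval₂_eq_eval_map, ← Polynomial.aeval_def]
    exact IsLocalization.integerNormalization_aeval_eq_zero _ _ (minpoly.aeval ℚ α)

/-- An algebraic real of degree at least two is irrational. -/
theorem irrational_of_two_le_natDegree_minpoly {α : ℝ} (h : 2 ≤ (minpoly ℚ α).natDegree) :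
    Irrational α := by
  rintro ⟨r, rfl⟩
  have := minpoly.eq_X_sub_C ℝ r
  simp only [eq_ratCast] at this
  rw [this, Polynomial.natDegree_X_sub_C] at h
  omega

/-- Liouville's inequality for integral linear forms in `1` and `α`. -/
theorem exists_one_le_mul_abs_add_mul {α : ℝ} {d : ℕ} (hd : 2 ≤ d)
    (halg : IsAlgebraic ℚ α) (hdeg : (minpoly ℚ α).natDegree = d) :
    ∃ K : ℝ, 1 ≤ K ∧ ∀ (A B : ℤ) (M : ℝ), ¬(A = 0 ∧ B = 0) → 1 ≤ M → |(B : ℝ)| ≤ M →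
      1 ≤ K * M ^ (d - 1) * |(A : ℝ) + B * α| := by
  obtain ⟨f, f0, fdeg, fα⟩ := exists_int_polynomial_root_of_isAlgebraic halg
  have hirr := irrational_of_two_le_natDegree_minpoly (hdeg ▸ hd)
  obtain ⟨K, hK, h⟩ := Liouville.exists_pos_real_of_irrational_root hirr f0 fα
  rw [hdeg] at fdeg
  refine ⟨max K 1, le_max_right _ _, fun A B M hAB hM hB => ?_⟩
  have hMp : (1 : ℝ) ≤ M ^ (d - 1) := one_le_pow₀ hM
  rcases eq_or_ne B 0 with rfl | hB0
  · have hA : A ≠ 0 := fun hA => hAB ⟨hA, rfl⟩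
    have hA1 : (1 : ℝ) ≤ |(A : ℝ)| := by exact_mod_cast Int.one_le_abs hA
    simp only [Int.cast_zero, zero_mul, add_zero]
    exact one_le_mul_of_one_le_of_one_le
      (one_le_mul_of_one_le_of_one_le (le_max_right _ _) hMp) hA1
  · obtain ⟨n, hn⟩ : ∃ n : ℕ, B.natAbs = n + 1 :=
      Nat.exists_eq_succ_of_ne_zero (Int.natAbs_ne_zero.2 hB0)
    have hBn : |(B : ℝ)| = (n : ℝ) + 1 := by
      rw [← Int.cast_abs, Int.abs_eq_natAbs, hn]; push_cast; rfl
    have hn0 : (0 : ℝ) < (n : ℝ) + 1 := by positivity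
    have key : ∃ A' : ℤ, ((n : ℝ) + 1) * |α - A' / ((n : ℝ) + 1)| = |(A : ℝ) + B * α| := by
      rcases abs_cases (B : ℝ) with ⟨h1, _⟩ | ⟨h1, _⟩
      · refine ⟨-A, ?_⟩
        rw [← abs_of_pos hn0, ← abs_mul, abs_of_pos hn0, mul_sub, mul_div_cancel₀ _ hn0.ne',
          ← hBn, h1]
        push_cast
        congr 1; ring
      · refine ⟨A, ?_⟩
        rw [← abs_of_pos hn0, ← abs_mul, abs_of_pos hn0, mul_sub, mul_div_cancel₀ _ hn0.ne',
          ← hBn, h1, ← abs_neg]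
        congr 1; ring
    obtain ⟨A', hA'⟩ := key
    calc (1 : ℝ) ≤ ((n : ℝ) + 1) ^ f.natDegree * (|α - A' / ((n : ℝ) + 1)| * K) := h A' n
      _ ≤ ((n : ℝ) + 1) ^ d * (|α - A' / ((n : ℝ) + 1)| * K) := by
        gcongr
        linarith [Nat.cast_nonneg (α := ℝ) n]
      _ = K * ((n : ℝ) + 1) ^ (d - 1) * (((n : ℝ) + 1) * |α - A' / ((n : ℝ) + 1)|) := by
        obtain ⟨e, rfl⟩ : ∃ e, d = e + 1 := ⟨d - 1, by omega⟩
        rw [Nat.add_sub_cancel, pow_succ]; ring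
      _ ≤ max K 1 * M ^ (d - 1) * |(A : ℝ) + B * α| := by
        rw [hA']
        gcongr
        · exact le_max_left _ _
        · exact hBn ▸ hB

/-- If `q` and `(a, b)` have no common factor and `q` divides `m * a` and `m * b`, then
`q ∣ m`. -/
theorem dvd_of_dvd_mul_of_gcd_eq_one {a b q m : ℤ} (h : Int.gcd a (Int.gcd b q) = 1)
    (ha : q ∣ m * a) (hb : q ∣ m * b) : q ∣ m := by
  have h1 : q ∣ m * (Int.gcd b q : ℤ) := by
    rw [Int.gcd_eq_gcd_ab, mul_add, ← mul_assoc, ← mul_assoc]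
    exact dvd_add (hb.mul_right _) ((dvd_mul_left q m).mul_right _)
  have h2 : q ∣ m * (Int.gcd a (Int.gcd b q) : ℤ) := by
    rw [Int.gcd_eq_gcd_ab, mul_add, ← mul_assoc, ← mul_assoc]
    exact dvd_add (ha.mul_right _) (h1.mul_right _)
  simpa [h] using h2

/-- Reduced triples representing the same point modulo one are equal. -/
theorem reduced_triple_unique {q q' : ℕ} {a a' b b' n : ℤ} (hq : 0 < q) (hq' : 0 < q')
    (ha : 1 ≤ a) (haq : a ≤ (q : ℤ)) (ha' : 1 ≤ a') (haq' : a' ≤ (q' : ℤ))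
    (hg : Int.gcd a (Int.gcd b (q : ℤ)) = 1) (hg' : Int.gcd a' (Int.gcd b' (q' : ℤ)) = 1)
    (hA : a * q' - a' * q - n * (q * q') = 0) (hB : b * q' - b' * q = 0) :
    a = a' ∧ b = b' ∧ q = q' := by
  have h1 : (q : ℤ) ∣ q' := dvd_of_dvd_mul_of_gcd_eq_one hg
    ⟨a' + n * q', by linear_combination hA⟩ ⟨b', by linear_combination hB⟩
  have h2 : (q' : ℤ) ∣ q := dvd_of_dvd_mul_of_gcd_eq_one hg'
    ⟨a - n * q, by linear_combination -hA⟩ ⟨b, by linear_combination -hB⟩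
  obtain rfl : q = q' := Nat.dvd_antisymm (Int.natCast_dvd_natCast.1 h1)
    (Int.natCast_dvd_natCast.1 h2)
  have hq0 : (q : ℤ) ≠ 0 := by exact_mod_cast hq.ne'
  have hb : b = b' := mul_right_cancel₀ hq0 (by linear_combination hB)
  have han : a - a' = n * q := mul_right_cancel₀ hq0 (by linear_combination hA)
  have hdiff : a - a' = 0 := Int.eq_zero_of_abs_lt_dvd ⟨n, by rw [han, mul_comm]⟩
    (abs_lt.2 ⟨by omega, by omega⟩)
  exact ⟨by omega, hb, rfl⟩

/-- **General separation condition** (Lemma: separation, very general).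
Let `α` be a real algebraic number of degree `d ≥ 2` and let `X, Y ≥ 1`.  Then there is a
constant `c = c(α) > 0` such that for all `(a, b, q) ≠ (a', b', q')` with `q, q' ∈ {1,…,⌊X⌋}`,
`|b|, |b'| ≤ Y`, `a ∈ {1,…,q}`, `a' ∈ {1,…,q'}` and `gcd(a,b,q) = gcd(a',b',q') = 1`,
`‖(a + bα)/q − (a' + b'α)/q'‖ > c X^{−d−1} Y^{−d+1}`. -/
theorem general_separation_condition
    (α : ℝ) (d : ℕ) (hd : 2 ≤ d)
    (halg : IsAlgebraic ℚ α) (hdeg : (minpoly ℚ α).natDegree = d) :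
    ∃ c > 0, ∀ (X Y : ℝ), 1 ≤ X → 1 ≤ Y →
      ∀ (q q' : ℕ) (a a' b b' : ℤ),
        0 < q → (q : ℝ) ≤ X → 0 < q' → (q' : ℝ) ≤ X →
        |(b : ℝ)| ≤ Y → |(b' : ℝ)| ≤ Y →
        1 ≤ a → a ≤ (q : ℤ) → 1 ≤ a' → a' ≤ (q' : ℤ) →
        Int.gcd a (Int.gcd b (q : ℤ)) = 1 → Int.gcd a' (Int.gcd b' (q' : ℤ)) = 1 →
        ¬(a = a' ∧ b = b' ∧ q = q') →
        distToInt (((a : ℝ) + (b : ℝ) * α) / q - ((a' : ℝ) + (b' : ℝ) * α) / q')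
          > c * X ^ (-(d : ℝ) - 1) * Y ^ (-(d : ℝ) + 1) := by
  obtain ⟨K, hK, hlin⟩ := exists_one_le_mul_abs_add_mul hd halg hdeg
  have hK0 : 0 < K := by linarith
  refine ⟨1 / (2 * (K * 2 ^ (d - 1))), by positivity, ?_⟩
  intro X Y hX hY q q' a a' b b' hq hqX hq' hqX' hb hb' ha haq ha' haq' hg hg' hne
  have hX0 : 0 < X := by linarith
  have hY0 : 0 < Y := by linarith
  have hq0 : (0 : ℝ) < q := by exact_mod_cast hq
  have hq0' : (0 : ℝ) < q' := by exact_mod_cast hq'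
  unfold distToInt
  generalize round (((a : ℝ) + (b : ℝ) * α) / q - ((a' : ℝ) + (b' : ℝ) * α) / q') = n
  set D := |((a : ℝ) + (b : ℝ) * α) / q - ((a' : ℝ) + (b' : ℝ) * α) / q' - (n : ℝ)| with hD
  have hDmul : |((a * q' - a' * q - n * (q * q') : ℤ) : ℝ) + ((b * q' - b' * q : ℤ) : ℝ) * α|
      = q * q' * D := by
    rw [hD, ← abs_of_pos (mul_pos hq0 hq0'), ← abs_mul]
    congr 1
    push_cast
    field_simp
    ring
  have hBbound : |((b * q' - b' * q : ℤ) : ℝ)| ≤ 2 * X * Y := by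
    push_cast
    calc |(b : ℝ) * q' - b' * q| ≤ |(b : ℝ) * q'| + |(b' : ℝ) * q| := abs_sub _ _
      _ = |(b : ℝ)| * q' + |(b' : ℝ)| * q := by
        rw [abs_mul, abs_mul, abs_of_pos hq0, abs_of_pos hq0']
      _ ≤ Y * X + Y * X := by gcongr
      _ = 2 * X * Y := by ring
  have hmain := hlin (a * q' - a' * q - n * (q * q')) (b * q' - b' * q) (2 * X * Y)
    (fun h => hne (reduced_triple_unique hq hq' ha haq ha' haq' hg hg' h.1 h.2))
    (by nlinarith) hBbound
  rw [hDmul] at hmain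
  have hlower : 1 ≤ K * 2 ^ (d - 1) * (X ^ (d + 1) * Y ^ (d - 1)) * D :=
    calc 1 ≤ K * (2 * X * Y) ^ (d - 1) * (q * q' * D) := hmain
      _ ≤ K * (2 * X * Y) ^ (d - 1) * (X * X * D) := by gcongr
      _ = K * 2 ^ (d - 1) * (X ^ (d + 1) * Y ^ (d - 1)) * D := by
        obtain ⟨e, rfl⟩ : ∃ e, d = e + 1 := ⟨d - 1, by omega⟩
        simp only [Nat.add_sub_cancel, mul_pow]
        ring
  have hXpow : X ^ (-(d : ℝ) - 1) = (X ^ (d + 1))⁻¹ := by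
    rw [← Real.rpow_natCast, ← Real.rpow_neg hX0.le]
    congr 1; push_cast; ring
  have hYpow : Y ^ (-(d : ℝ) + 1) = (Y ^ (d - 1))⁻¹ := by
    rw [← Real.rpow_natCast, ← Real.rpow_neg hY0.le, Nat.cast_sub (by omega)]
    congr 1; push_cast; ring
  rw [hXpow, hYpow, gt_iff_lt]
  have hP : 0 < K * 2 ^ (d - 1) * (X ^ (d + 1) * Y ^ (d - 1)) := by positivity
  calc 1 / (2 * (K * 2 ^ (d - 1))) * (X ^ (d + 1))⁻¹ * (Y ^ (d - 1))⁻¹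
      = 1 / (2 * (K * 2 ^ (d - 1) * (X ^ (d + 1) * Y ^ (d - 1)))) := by
        field_simp
    _ < D := by
      rw [div_lt_iff₀ (by positivity)]
      linarith
end

section
/- Let α be a real algebraic number of degree d ≥ 2 and let γ₁, γ₂, γ₃ ∈ (0, 1) satisfy (d+1)γ₁ + (d−1)γ₂ + γ₃ < 1. Then there exists a positive constant C = C(α, γ₁, γ₂, γ₃) such that for all N ≥ C and all triples (a, b, q) ≠ (a', b', q') with q, q' ∈ {1, ..., ⌊N^{γ₁}⌋}, b, b' ∈ ℤ with |b|, |b'| ≤ N^{γ₂}, a ∈ {1, ..., q}, a' ∈ {1, ..., q'} and gcd(a, b, q) = gcd(a', b', q') = 1, one has ‖ (a + bα)/q − (a' + b'α)/q' ‖ > 2 N^{−1+γ₃}. -/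
/-- An algebraic real is a root of an integer polynomial of the same degree as its minimal
polynomial over `ℚ`. -/
theorem exists_int_polynomial_natDegree_eq_minpoly {α : ℝ} (halg : IsAlgebraic ℚ α) :
    ∃ f : Polynomial ℤ, f ≠ 0 ∧ f.natDegree = (minpoly ℚ α).natDegree ∧
      Polynomial.eval α (f.map (algebraMap ℤ ℝ)) = 0 := by
  have hp : minpoly ℚ α ≠ 0 := minpoly.ne_zero halg.isIntegral
  obtain ⟨b, hbM, hb⟩ := IsLocalization.integerNormalization_spec
    (nonZeroDivisors ℤ) (minpoly ℚ α)
  have hb0 : b ≠ 0 := nonZeroDivisors.ne_zero hbM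
  set f := IsLocalization.integerNormalization (nonZeroDivisors ℤ) (minpoly ℚ α)
  have hinj : Function.Injective (algebraMap ℤ ℚ) := Int.cast_injective
  have hdeg : f.natDegree = (minpoly ℚ α).natDegree := by
    rw [← Polynomial.natDegree_map_eq_of_injective hinj f, hb,
      Polynomial.natDegree_smul _ hb0]
  refine ⟨f, ?_, hdeg, ?_⟩
  · intro hf
    rw [hf, Polynomial.map_zero] at hb
    exact smul_ne_zero hb0 hp hb.symm
  · have h1 : Polynomial.aeval α (f.map (algebraMap ℤ ℚ)) = 0 := by
      rw [hb, map_zsmul, minpoly.aeval, smul_zero]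
    rwa [Polynomial.aeval_map_algebraMap, Polynomial.aeval_def, ← Polynomial.eval_map] at h1

/-- Liouville's inequality for nonzero integral linear forms in `1` and `α`. -/
theorem exists_pos_le_pow_mul_abs_add_mul {α : ℝ} (halg : IsAlgebraic ℚ α)
    (hdeg : 2 ≤ (minpoly ℚ α).natDegree) :
    ∃ c > 0, ∀ (A B : ℤ) (M : ℝ), 1 ≤ M → |(B : ℝ)| ≤ M → ¬(A = 0 ∧ B = 0) →
      c ≤ M ^ ((minpoly ℚ α).natDegree - 1) * |(A : ℝ) + B * α| := by
  obtain ⟨f, hf, hfd, hroot⟩ := exists_int_polynomial_natDegree_eq_minpoly halg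
  obtain ⟨K, hK, hL⟩ := Liouville.exists_pos_real_of_irrational_root
    (irrational_of_two_le_natDegree_minpoly hdeg) hf hroot
  rw [hfd] at hL
  obtain ⟨k, hk⟩ : ∃ k, (minpoly ℚ α).natDegree = k + 1 := 
    ⟨(minpoly ℚ α).natDegree - 1, by omega⟩
  rw [hk] at hL ⊢
  rw [Nat.add_sub_cancel]
  have pos_case : ∀ (A : ℤ) (n : ℕ),
      1 / K ≤ ((n : ℝ) + 1) ^ k * |(A : ℝ) + ((n : ℝ) + 1) * α| := by
    intro A n
    have h := hL (-A) n
    have hn : (0 : ℝ) < (n : ℝ) + 1 := by positivity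
    have he : |(A : ℝ) + ((n : ℝ) + 1) * α|
        = ((n : ℝ) + 1) * |α - ((-A : ℤ) : ℝ) / ((n : ℝ) + 1)| := by
      rw [← abs_of_pos hn, ← abs_mul, abs_of_pos hn]
      congr 1
      push_cast
      field_simp
      ring
    rw [he, div_le_iff₀ hK]
    calc (1 : ℝ) ≤ _ := h
      _ = _ := by ring
  have nonzero_case : ∀ A B : ℤ, B ≠ 0 → 1 / K ≤ |(B : ℝ)| ^ k * |(A : ℝ) + B * α| := by
    intro A B hB
    obtain ⟨n, hn⟩ : ∃ n : ℕ, B.natAbs = n + 1 := ⟨B.natAbs - 1, by omega⟩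
    rcases (by omega : B = n + 1 ∨ B = -(n + 1)) with rfl | rfl
    · have h := pos_case A n
      push_cast
      rwa [abs_of_pos (by positivity : (0 : ℝ) < (n : ℝ) + 1)]
    · have h := pos_case (-A) n
      push_cast at h ⊢
      rw [abs_neg ((n : ℝ) + 1), abs_of_pos (by positivity : (0 : ℝ) < (n : ℝ) + 1)]
      rwa [← abs_neg ((A : ℝ) + _), show -((A : ℝ) + -((n : ℝ) + 1) * α)
        = -(A : ℝ) + ((n : ℝ) + 1) * α by ring]
  refine ⟨min (1 / K) 1, by positivity, fun A B M hM hBM hAB => ?_⟩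
  by_cases hB : B = 0
  · have hA : A ≠ 0 := fun h => hAB ⟨h, hB⟩
    have h1 : (1 : ℝ) ≤ |(A : ℝ)| := by exact_mod_cast Int.one_le_abs hA
    subst hB
    simpa using Or.inr (one_le_mul_of_one_le_of_one_le (one_le_pow₀ hM (n := k)) h1)
  · calc min (1 / K) 1 ≤ 1 / K := min_le_left _ _
      _ ≤ _ := nonzero_case A B hB
      _ ≤ _ := by gcongr

theorem dvd_of_gcd_eq_one_of_dvd_mul {a b q m : ℤ} (h : Int.gcd a (Int.gcd b q) = 1)
    (ha : q ∣ a * m) (hb : q ∣ b * m) : q ∣ m := by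
  have h1 : q ∣ (Int.gcd b q : ℤ) * m := by
    rw [Int.gcd_eq_gcd_ab b q, add_mul]
    exact dvd_add (by convert hb.mul_right (Int.gcdA b q) using 1; ring)
      ⟨Int.gcdB b q * m, by ring⟩
  have h2 : q ∣ (Int.gcd a (Int.gcd b q) : ℤ) * m := by
    rw [Int.gcd_eq_gcd_ab a, add_mul]
    exact dvd_add (by convert ha.mul_right (Int.gcdA a (Int.gcd b q)) using 1; ring)
      (by convert h1.mul_right (Int.gcdB a (Int.gcd b q)) using 1; ring)
  simpa [h] using h2

/-- Two reduced triples whose centers agree formally modulo one are equal. -/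
theorem eq_of_reduced_of_mul_eq {a b a' b' n : ℤ} {q q' : ℕ} (hq : 0 < q) (hq' : 0 < q')
    (ha : 1 ≤ a) (haq : a ≤ q) (ha' : 1 ≤ a') (haq' : a' ≤ q')
    (h : Int.gcd a (Int.gcd b (q : ℤ)) = 1) (h' : Int.gcd a' (Int.gcd b' (q' : ℤ)) = 1)
    (hA : a * q' - a' * q - n * (q * q') = 0) (hB : b * q' - b' * q = 0) :
    a = a' ∧ b = b' ∧ q = q' := by
  have h1 : (q : ℤ) ∣ q' := dvd_of_gcd_eq_one_of_dvd_mul h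
    ⟨a' + n * q', by linear_combination hA⟩ ⟨b', by linear_combination hB⟩
  have h2 : (q' : ℤ) ∣ q := dvd_of_gcd_eq_one_of_dvd_mul h'
    ⟨a - n * q, by linear_combination -hA⟩ ⟨b, by linear_combination -hB⟩
  obtain rfl : q = q' := Nat.dvd_antisymm (Int.natCast_dvd_natCast.mp h1)
    (Int.natCast_dvd_natCast.mp h2)
  have hq0 : (q : ℤ) ≠ 0 := by omega
  refine ⟨?_, mul_right_cancel₀ hq0 (sub_eq_zero.mp hB), rfl⟩
  have h3 : a - a' = n * q := mul_right_cancel₀ hq0 (by linear_combination hA)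
  have h4 : a - a' = 0 := Int.eq_zero_of_abs_lt_dvd ⟨n, by rw [h3, mul_comm]⟩
    (abs_lt.mpr ⟨by omega, by omega⟩)
  omega

/-- **Separation condition for the major arc centers** (Lemma: separation, general).
Let `α` be a real algebraic number of degree `d ≥ 2` and `γ₁, γ₂, γ₃ ∈ (0,1)` with
`(d+1)γ₁ + (d−1)γ₂ + γ₃ < 1`.  Then there exists `C = C(α, γ₁, γ₂, γ₃) > 0` such that for all
`N ≥ C` and all `(a, b, q) ≠ (a', b', q')` with `q, q' ∈ {1,…,⌊N^{γ₁}⌋}`, `|b|, |b'| ≤ N^{γ₂}`,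
`a ∈ {1,…,q}`, `a' ∈ {1,…,q'}` and `gcd(a,b,q) = gcd(a',b',q') = 1`,
`‖(a + bα)/q − (a' + b'α)/q'‖ > 2 N^{−1+γ₃}`. -/
theorem separation_condition_major_arc_centers
    (α : ℝ) (d : ℕ) (hd : 2 ≤ d)
    (halg : IsAlgebraic ℚ α) (hdeg : (minpoly ℚ α).natDegree = d)
    (γ₁ γ₂ γ₃ : ℝ) (hγ₁ : γ₁ ∈ Set.Ioo (0 : ℝ) 1) (hγ₂ : γ₂ ∈ Set.Ioo (0 : ℝ) 1)
    (hγ₃ : γ₃ ∈ Set.Ioo (0 : ℝ) 1)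
    (hsum : ((d : ℝ) + 1) * γ₁ + ((d : ℝ) - 1) * γ₂ + γ₃ < 1) :
    ∃ C > 0, ∀ (N : ℝ), C ≤ N →
      ∀ (q q' : ℕ) (a a' b b' : ℤ),
        0 < q → (q : ℝ) ≤ N ^ γ₁ → 0 < q' → (q' : ℝ) ≤ N ^ γ₁ →
        |(b : ℝ)| ≤ N ^ γ₂ → |(b' : ℝ)| ≤ N ^ γ₂ →
        1 ≤ a → a ≤ (q : ℤ) → 1 ≤ a' → a' ≤ (q' : ℤ) →
        Int.gcd a (Int.gcd b (q : ℤ)) = 1 → Int.gcd a' (Int.gcd b' (q' : ℤ)) = 1 →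
        ¬(a = a' ∧ b = b' ∧ q = q') →
        distToInt (((a : ℝ) + (b : ℝ) * α) / q - ((a' : ℝ) + (b' : ℝ) * α) / q')
          > 2 * N ^ (-1 + γ₃) := by
  subst hdeg
  set d := (minpoly ℚ α).natDegree
  obtain ⟨c, hc, hL⟩ := exists_pos_le_pow_mul_abs_add_mul halg hd
  have hd' : ((d - 1 : ℕ) : ℝ) = (d : ℝ) - 1 := by
    rw [Nat.cast_sub (by omega), Nat.cast_one]
  set s := ((d : ℝ) + 1) * γ₁ + ((d : ℝ) - 1) * γ₂ with hs
  have hev := (tendsto_rpow_atTop (by linarith : 0 < 1 - γ₃ - s)).eventually_gt_atTop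
    (2 * 2 ^ (d - 1) / c)
  obtain ⟨C, hC⟩ := Filter.eventually_atTop.mp hev
  refine ⟨max C 1, by positivity, ?_⟩
  intro N hN q q' a a' b b' hq hqN hq' hqN' hb hb' ha haq ha' haq' hg hg' hne
  have hN1 : 1 ≤ N := (le_max_right _ _).trans hN
  have hN0 : 0 < N := by linarith
  have hbig := hC N ((le_max_left _ _).trans hN)
  have hqR : (0 : ℝ) < q := by exact_mod_cast hq
  have hqR' : (0 : ℝ) < q' := by exact_mod_cast hq'
  rw [distToInt]
  generalize round (((a : ℝ) + (b : ℝ) * α) / q - ((a' : ℝ) + (b' : ℝ) * α) / q') = n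
  have hx : ((a : ℝ) + b * α) / q - (a' + b' * α) / q' - n
      = (((a * q' - a' * q - n * (q * q') : ℤ) : ℝ) + ((b * q' - b' * q : ℤ) : ℝ) * α)
        / (q * q') := by
    push_cast
    field_simp
    ring
  have hM1 : 1 ≤ 2 * N ^ (γ₁ + γ₂) := by
    have := Real.one_le_rpow hN1 (add_pos hγ₁.1 hγ₂.1).le
    linarith
  have hBM : |((b * q' - b' * q : ℤ) : ℝ)| ≤ 2 * N ^ (γ₁ + γ₂) := by
    push_cast
    calc |(b : ℝ) * q' - b' * q| ≤ |(b : ℝ) * q'| + |(b' : ℝ) * q| := abs_sub _ _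
      _ = |(b : ℝ)| * q' + |(b' : ℝ)| * q := by
        rw [abs_mul, abs_mul, Nat.abs_cast, Nat.abs_cast]
      _ ≤ N ^ γ₂ * N ^ γ₁ + N ^ γ₂ * N ^ γ₁ := by gcongr
      _ = 2 * N ^ (γ₁ + γ₂) := by rw [Real.rpow_add hN0]; ring
  have hlow := hL (a * q' - a' * q - n * (q * q')) _ _ hM1 hBM fun h =>
    hne (eq_of_reduced_of_mul_eq hq hq' ha haq ha' haq' hg hg' h.1 h.2)
  rw [hx, abs_div, abs_of_pos (mul_pos hqR hqR')]
  set L := |((a * q' - a' * q - n * (q * q') : ℤ) : ℝ) + ((b * q' - b' * q : ℤ) : ℝ) * α|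
  have hqq : (q : ℝ) * q' ≤ N ^ γ₁ * N ^ γ₁ := by gcongr
  have hmain : 2 * N ^ (-1 + γ₃) * (N ^ γ₁ * N ^ γ₁) * (2 * N ^ (γ₁ + γ₂)) ^ (d - 1) < c := by
    rw [mul_pow, ← Real.rpow_mul_natCast hN0.le, hd']
    have he : N ^ (-1 + γ₃) * (N ^ γ₁ * N ^ γ₁) * N ^ ((γ₁ + γ₂) * ((d : ℝ) - 1))
        * N ^ (1 - γ₃ - s) = 1 := by
      simp only [← Real.rpow_add hN0]
      rw [hs]
      ring_nf
      exact Real.rpow_zero N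
    rw [div_lt_iff₀ hc] at hbig
    have hP : 0 < N ^ (-1 + γ₃) * (N ^ γ₁ * N ^ γ₁) * N ^ ((γ₁ + γ₂) * ((d : ℝ) - 1)) := by
      positivity
    calc _ = N ^ (-1 + γ₃) * (N ^ γ₁ * N ^ γ₁) * N ^ ((γ₁ + γ₂) * ((d : ℝ) - 1))
          * (2 * 2 ^ (d - 1)) := by ring
      _ < N ^ (-1 + γ₃) * (N ^ γ₁ * N ^ γ₁) * N ^ ((γ₁ + γ₂) * ((d : ℝ) - 1))
          * (N ^ (1 - γ₃ - s) * c) := by gcongr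
      _ = c := by rw [← mul_assoc, he, one_mul]
  rw [gt_iff_lt, lt_div_iff₀ (mul_pos hqR hqR')]
  have hMpos : 0 < (2 * N ^ (γ₁ + γ₂)) ^ (d - 1) := by positivity
  refine lt_of_mul_lt_mul_left ?_ hMpos.le
  calc _ ≤ (2 * N ^ (γ₁ + γ₂)) ^ (d - 1) * (2 * N ^ (-1 + γ₃) * (N ^ γ₁ * N ^ γ₁)) := by gcongr
    _ < c := by linarith
    _ ≤ _ := hlow
end

section
/- Let k₁, k₂ ∈ ℕ with gcd(k₁, k₂) = 1 and set k = k₁/k₂. Then there exists a positive constant C = C(k₁, k₂) such that for all q ∈ ℕ and a, b ∈ ℤ with gcd(a, b, q) = 1, one has |G_{k}(a, b, q)| ≤ C q^{−1/2}. -/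
open Finset in
/-- A sum over `{1, …, N}` of a function of the residue mod `N` is a sum over `ZMod N`. -/
theorem sum_Icc_natCast_zmod {M : Type*} [AddCommMonoid M] (N : ℕ) [NeZero N] (g : ZMod N → M) :
    ∑ i ∈ Icc 1 N, g (i : ZMod N) = ∑ x : ZMod N, g x := by
  have hrange : ∀ f : ZMod N → M, ∑ i ∈ range N, f (i : ZMod N) = ∑ x : ZMod N, f x := by
    intro f
    refine sum_nbij' (fun i : ℕ => (i : ZMod N)) ZMod.val (by simp) ?_ ?_ (by simp) (by simp)
    · intro x _
      simpa using ZMod.val_lt x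
    · intro i hi
      exact ZMod.val_cast_of_lt (by simpa using hi)
  have hshift : ∑ i ∈ Icc 1 N, g (i : ZMod N) = ∑ i ∈ range N, g ((i : ZMod N) + 1) := by
    refine sum_nbij' (fun i => i - 1) (fun i => i + 1) ?_ ?_ ?_ ?_ ?_
    · intro i hi
      simp only [mem_Icc, mem_range] at *
      omega
    · intro i hi
      simp only [mem_Icc, mem_range] at *
      omega
    · intro i hi
      simp only [mem_Icc] at hi
      omega
    · intro i _
      simp
    · intro i hi
      simp only [mem_Icc] at hi
      obtain ⟨j, rfl⟩ := Nat.exists_eq_add_of_le' hi.1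
      simp
  rw [hshift, hrange fun x => g (x + 1)]
  exact Fintype.sum_equiv (Equiv.addRight 1) _ _ fun x => rfl

theorem expc_eq_stdAddChar (N : ℕ) [NeZero N] (m : ℤ) (x : ℝ) (hx : x = m / N) :
    expc x = ZMod.stdAddChar (N := N) (m : ZMod N) := by
  rw [ZMod.stdAddChar_coe, expc, hx]
  congr 1
  push_cast
  ring

open Finset in
/-- Multiplication by `m` on `ZMod (m * q)` has at most `m` zeros. -/
theorem card_mul_eq_zero_le (m q : ℕ) (hm : 0 < m) [NeZero (m * q)] :
    #{t : ZMod (m * q) | (m : ZMod (m * q)) * t = 0} ≤ m := by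
  have hsub : ({t : ZMod (m * q) | (m : ZMod (m * q)) * t = 0} : Finset _) ⊆
      (range m).image fun j : ℕ => ((q * j : ℕ) : ZMod (m * q)) := by
    intro t ht
    simp only [mem_filter, mem_univ, true_and] at ht
    rw [← ZMod.natCast_zmod_val t, ← Nat.cast_mul, ZMod.natCast_eq_zero_iff] at ht
    obtain ⟨j, hj⟩ := Nat.dvd_of_mul_dvd_mul_left hm ht
    refine mem_image.2 ⟨j, ?_, ?_⟩
    · have hlt := ZMod.val_lt t
      rw [hj, mul_comm m q] at hlt
      exact mem_range.2 (lt_of_mul_lt_mul_left hlt (Nat.zero_le q))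
    · rw [← hj, ZMod.natCast_zmod_val]
  calc _ ≤ _ := card_le_card hsub
    _ ≤ _ := card_image_le
    _ = m := card_range m

open Finset in
/-- Second moment of the sums `∑ s, ψ (α r s + β s ^ 2 + γ r ^ 2)` over the linear parameter. -/
theorem sum_norm_sq_quadratic_le (N : ℕ) [NeZero N] (α β γ : ZMod N) :
    ∑ r : ZMod N, ‖∑ s : ZMod N,
        ZMod.stdAddChar (N := N) (α * r * s + β * s ^ 2 + γ * r ^ 2)‖ ^ 2 ≤
      (N : ℝ) ^ 2 * #{t : ZMod N | α * t = 0 ∧ 2 * β * t = 0} := by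
  set ψ := ZMod.stdAddChar (N := N)
  have hprim : ψ.IsPrimitive := ZMod.isPrimitive_stdAddChar N
  have hexpand : ((∑ r : ZMod N, ‖∑ s : ZMod N, ψ (α * r * s + β * s ^ 2 + γ * r ^ 2)‖ ^ 2 : ℝ) : ℂ)
      = ∑ t : ZMod N, ψ (β * t ^ 2) *
          ((∑ r, ψ (r * (α * t))) * ∑ s, ψ (s * (2 * β * t))) := by
    have hr : ∀ r : ZMod N,
        ((‖∑ s : ZMod N, ψ (α * r * s + β * s ^ 2 + γ * r ^ 2)‖ ^ 2 : ℝ) : ℂ) =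
          ∑ s, ∑ t, ψ (β * t ^ 2) * (ψ (r * (α * t)) * ψ (s * (2 * β * t))) := by
      intro r
      rw [Complex.ofReal_pow, ← Complex.conj_mul', map_sum, sum_mul_sum]
      refine sum_congr rfl fun s _ => ?_
      rw [← Fintype.sum_equiv (Equiv.addLeft s) _ _ fun t => rfl]
      refine sum_congr rfl fun t _ => ?_
      rw [← AddChar.map_neg_eq_conj, ← AddChar.map_add_eq_mul, ← AddChar.map_add_eq_mul,
        ← AddChar.map_add_eq_mul]
      congr 1
      simp only [Equiv.coe_addLeft]
      ring
    rw [Complex.ofReal_sum, sum_congr rfl fun r _ => hr r]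
    simp_rw [sum_mul_sum, mul_sum]
    rw [sum_congr rfl fun r _ => sum_comm, sum_comm]
  have hbound : ∀ t : ZMod N, ‖ψ (β * t ^ 2) *
      ((∑ r, ψ (r * (α * t))) * ∑ s, ψ (s * (2 * β * t)))‖ ≤
        if α * t = 0 ∧ 2 * β * t = 0 then (N : ℝ) ^ 2 else 0 := by
    intro t
    rw [AddChar.sum_mulShift _ hprim, AddChar.sum_mulShift _ hprim, norm_mul, AddChar.norm_apply,
      ZMod.card]
    by_cases h₁ : α * t = 0 <;> by_cases h₂ : 2 * β * t = 0 <;> simp [h₁, h₂, sq]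
  calc _ = ‖((∑ r : ZMod N, ‖∑ s : ZMod N,
            ψ (α * r * s + β * s ^ 2 + γ * r ^ 2)‖ ^ 2 : ℝ) : ℂ)‖ := by
        rw [Complex.norm_real, Real.norm_of_nonneg (by positivity)]
    _ ≤ ∑ t : ZMod N, if α * t = 0 ∧ 2 * β * t = 0 then (N : ℝ) ^ 2 else 0 := by
        rw [hexpand]
        exact norm_sum_le_of_le _ fun t _ => hbound t
    _ = _ := by
        rw [← sum_filter, sum_const, nsmul_eq_mul, mul_comm]

/-- If `gcd (a, b, q) = 1`, then `a m t = b m t = 0` in `ZMod (m * q)` forces `m t = 0`. -/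
theorem mul_eq_zero_of_gcd_eq_one (m q : ℕ) (a b : ℤ)
    (h : Int.gcd a (Int.gcd b (q : ℤ)) = 1) (t : ZMod (m * q))
    (ha : (a * m : ZMod (m * q)) * t = 0) (hb : (b * m : ZMod (m * q)) * t = 0) :
    (m : ZMod (m * q)) * t = 0 := by
  have hq : (m * q : ZMod (m * q)) = 0 := by exact_mod_cast ZMod.natCast_self (m * q)
  have h₁ := Int.gcd_eq_gcd_ab a (Int.gcd b (q : ℤ))
  rw [h, Int.gcd_eq_gcd_ab b q] at h₁
  have h₂ := congrArg (Int.cast : ℤ → ZMod (m * q)) h₁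
  push_cast at h₂
  linear_combination (m * t) * h₂ + (Int.gcdA a _ : ZMod (m * q)) * ha +
    (Int.gcdB a _ * Int.gcdA b q : ZMod (m * q)) * hb +
    (Int.gcdB a _ * Int.gcdB b q * t : ZMod (m * q)) * hq

theorem Gfactor_eq_sum_zmod (k₁ k₂ q : ℕ) (hk₂ : 0 < k₂) (hq : 0 < q) (a b : ℤ)
    [NeZero (2 * k₂ * q)] :
    Gfactor k₁ k₂ a b q = (((2 * k₂ * q : ℕ) : ℂ) ^ 2)⁻¹ *
      ∑ r : ZMod (2 * k₂ * q), ∑ s : ZMod (2 * k₂ * q), ZMod.stdAddChar (N := 2 * k₂ * q)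
        ((a * (2 * k₂ : ℕ)) * r * s + (b * k₂) * s ^ 2 + (b * k₁) * r ^ 2) := by
  have hN : 2 * q * k₂ = 2 * k₂ * q := by ring
  rw [Gfactor, hN, ← sum_Icc_natCast_zmod]
  congr 1
  refine Finset.sum_congr rfl fun r _ => ?_
  rw [← sum_Icc_natCast_zmod]
  refine Finset.sum_congr rfl fun s _ => ?_
  rw [expc_eq_stdAddChar (2 * k₂ * q)
    (a * (2 * k₂ : ℕ) * r * s + b * k₂ * s ^ 2 + b * k₁ * r ^ 2)]
  · push_cast
    rfl
  · have : (q : ℝ) ≠ 0 := by positivity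
    have : (k₂ : ℝ) ≠ 0 := by positivity
    push_cast
    field_simp
    ring

/-- **Bounds for `G_k`** (Proposition: Gauss sums type).
Let `k₁, k₂ ∈ ℕ` with `gcd(k₁, k₂) = 1` and `k = k₁/k₂`.  Then there exists
`C = C(k₁,k₂) > 0` such that for all `q ∈ ℕ` and `a, b ∈ ℤ` with `gcd(a, b, q) = 1`,
`|G_k(a,b,q)| ≤ C q^{−1/2}`. -/
theorem Gfactor_bound (k₁ k₂ : ℕ) (hk₁ : 0 < k₁) (hk₂ : 0 < k₂)
    (hcop : Nat.Coprime k₁ k₂) :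
    ∃ C > 0, ∀ (q : ℕ), 0 < q → ∀ (a b : ℤ), Int.gcd a (Int.gcd b (q : ℤ)) = 1 →
      ‖Gfactor k₁ k₂ a b q‖ ≤ C * (q : ℝ) ^ (-(1 / 2 : ℝ)) := by
  refine ⟨1, one_pos, fun q hq a b hab => ?_⟩
  have : NeZero (2 * k₂ * q) := ⟨by positivity⟩
  rw [Gfactor_eq_sum_zmod k₁ k₂ q hk₂ hq, norm_mul]
  set F : ZMod (2 * k₂ * q) → ℂ := fun r => ∑ s : ZMod (2 * k₂ * q),
    ZMod.stdAddChar (N := 2 * k₂ * q)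
      ((a * (2 * k₂ : ℕ)) * r * s + (b * k₂) * s ^ 2 + (b * k₁) * r ^ 2)
  have hcard : Finset.card {t : ZMod (2 * k₂ * q) |
      (a * (2 * k₂ : ℕ)) * t = 0 ∧ 2 * (b * k₂ : ZMod (2 * k₂ * q)) * t = 0} ≤ 2 * k₂ := by
    refine le_trans (Finset.card_le_card fun t ht => ?_)
      (card_mul_eq_zero_le (2 * k₂) q (by positivity))
    simp only [Finset.mem_filter, Finset.mem_univ, true_and] at ht ⊢
    refine mul_eq_zero_of_gcd_eq_one (2 * k₂) q a b hab t ht.1 ?_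
    rw [← ht.2]
    push_cast
    ring
  have hmoment : ∑ r, ‖F r‖ ^ 2 ≤ ((2 * k₂ * q : ℕ) : ℝ) ^ 2 * (2 * k₂ : ℕ) :=
    (sum_norm_sq_quadratic_le _ _ _ _).trans (by gcongr)
  have hsq : ‖∑ r, F r‖ ^ 2 ≤
      (2 * k₂ * q : ℕ) * (((2 * k₂ * q : ℕ) : ℝ) ^ 2 * (2 * k₂ : ℕ)) := by
    calc ‖∑ r, F r‖ ^ 2 ≤ (∑ r, ‖F r‖) ^ 2 := by
          gcongr
          exact norm_sum_le _ _
      _ ≤ (2 * k₂ * q : ℕ) * ∑ r, ‖F r‖ ^ 2 := by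
          simpa [ZMod.card] using
            sq_sum_le_card_mul_sum_sq (s := Finset.univ) (f := fun r => ‖F r‖)
      _ ≤ _ := by gcongr
  have hq' : (0 : ℝ) < q := by positivity
  have hk' : (0 : ℝ) < k₂ := by positivity
  have hrpow : ((q : ℝ) ^ (-(1 / 2 : ℝ))) ^ 2 = (q : ℝ)⁻¹ := by
    rw [← Real.rpow_natCast, ← Real.rpow_mul hq'.le, ← Real.rpow_neg_one]
    norm_num
  refine (sq_le_sq₀ (by positivity) (by positivity)).1 ?_
  rw [mul_pow, one_mul, hrpow, norm_inv, norm_pow, Complex.norm_natCast]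
  calc _ ≤ ((((2 * k₂ * q : ℕ) : ℝ) ^ 2)⁻¹) ^ 2 *
        ((2 * k₂ * q : ℕ) * (((2 * k₂ * q : ℕ) : ℝ) ^ 2 * (2 * k₂ : ℕ))) := by gcongr
    _ = (q : ℝ)⁻¹ := by
        push_cast
        field_simp
end
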